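/- arXiv:1903.05923 — 2 statements merged into one kernel-verified Lean document; each statement's English description precedes it below -/
import Mathlib

section
/- Let d ≥ 2. Then there exists α₀ = α₀(d) > 0 such that, with the modulus of continuity ω(t) = t(log(1/t))^{α₀} (defined on a suitable interval (0, a) with a ∈ (0,1)), there exists a separated net X ⊆ ℝ^d which is not bi-ω equivalent to the integer lattice ℤ^d. -/
open MeasureTheory Metric Set Filter

noncomputable section

/-- `ℝ^d` with the Euclidean norm. -/
abbrev Euc (d : ℕ) := EuclideanSpace ℝ (Fin d)

/-- The integer lattice `ℤ^d ⊆ ℝ^d`. -/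
def intLattice (d : ℕ) : Set (Euc d) := {x | ∀ i, ∃ m : ℤ, x i = (m : ℝ)}

/-- The unit cube `I^d = [0,1]^d ⊆ ℝ^d`. -/
def unitCube (d : ℕ) : Set (Euc d) := {x | ∀ i, x i ∈ Icc (0:ℝ) 1}

/-- `X` is a separated net in `ℝ^d`: it is `r`-separated and an `s`-net for some `r, s > 0`. -/
def IsSeparatedNet {d : ℕ} (X : Set (Euc d)) : Prop :=
  ∃ r s : ℝ, 0 < r ∧ 0 < s ∧
    (∀ x ∈ X, ∀ y ∈ X, x ≠ y → r ≤ dist x y) ∧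
    ∀ z : Euc d, ∃ x ∈ X, dist z x ≤ s

/-- Membership of `ω : (0, a) → (0, ∞)` in the class `𝓜` of strictly increasing, concave,
submultiplicative moduli of continuity with `ω(t) ≥ t` and `ω(t) → 0` as `t → 0⁺`;
here `ω` is represented as a total function `ℝ → ℝ`, only its values on `(0, a)` matter. -/
structure MemM (ω : ℝ → ℝ) (a : ℝ) : Prop where
  a_pos : 0 < a
  a_le_one : a ≤ 1
  mono : StrictMonoOn ω (Ioo 0 a)
  concave : ConcaveOn ℝ (Ioo 0 a) ω
  subm : ∀ s ∈ Ioo (0:ℝ) a, ∀ t ∈ Ioo (0:ℝ) a, ω (s * t) ≤ ω s * ω t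
  pos : ∀ t ∈ Ioo (0:ℝ) a, 0 < ω t
  le_omega : ∀ t ∈ Ioo (0:ℝ) a, t ≤ ω t
  tendsto_zero : Tendsto ω (nhdsWithin 0 (Ioi 0)) (nhds 0)

/-- `f` is a bi-`ω`-mapping on `A` (with `ω` a modulus defined on `(0, a)`): `f` is injective on
`A` and there is `K > 0` with `dist (f x) (f y) ≤ K ω (dist x y)` and
`dist x y ≤ K ω (dist (f x) (f y))`, the bounds being imposed only when the argument of `ω` lies
in `(0, a)`. -/
def IsBiOmegaMapOn {E F : Type*} [PseudoMetricSpace E] [PseudoMetricSpace F]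
    (ω : ℝ → ℝ) (a : ℝ) (f : E → F) (A : Set E) : Prop :=
  Set.InjOn f A ∧
  ∃ K : ℝ, 0 < K ∧
    (∀ x ∈ A, ∀ y ∈ A, 0 < dist x y → dist x y < a →
      dist (f x) (f y) ≤ K * ω (dist x y)) ∧
    (∀ x ∈ A, ∀ y ∈ A, 0 < dist (f x) (f y) → dist (f x) (f y) < a →
      dist x y ≤ K * ω (dist (f x) (f y)))

/-- A set `P` in a metric space is porous. -/
def IsPorous {E : Type*} [PseudoMetricSpace E] (P : Set E) : Prop :=
  ∀ x : E, ∃ ε₀ : ℝ, 0 < ε₀ ∧ ∃ α ∈ Ioo (0:ℝ) 1, ∀ ε ∈ Ioo (0:ℝ) ε₀,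
    ∃ y : E, dist y x ≤ ε ∧ ball y (α * ε) ∩ P = ∅

/-- A set is σ-porous if it is a countable union of porous sets. -/
def IsSigmaPorous {E : Type*} [PseudoMetricSpace E] (P : Set E) : Prop :=
  ∃ F : ℕ → Set E, (∀ n, IsPorous (F n)) ∧ P = ⋃ n, F n

/-- `f : X → ℝ^d` is a homogeneous `ω`-mapping with some constant `K > 0`, for a modulus `ω`
defined on `(0, a)`:  `‖f x₂ - f x₁‖ ≤ K R ω (‖x₂ - x₁‖ / R)` for all `R > 0` and
`x₁, x₂ ∈ X ∩ B(0, R)`, the bound being imposed only when the argument of `ω` lies in `(0,a)`. -/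
def IsHomogeneousOmegaMap {d : ℕ} (ω : ℝ → ℝ) (a : ℝ)
    (A : Set (Euc d)) (f : Euc d → Euc d) : Prop :=
  ∃ K : ℝ, 0 < K ∧ ∀ R : ℝ, 0 < R → ∀ x₁ ∈ A ∩ ball 0 R, ∀ x₂ ∈ A ∩ ball 0 R,
    0 < dist x₂ x₁ / R → dist x₂ x₁ / R < a →
      dist (f x₂) (f x₁) ≤ K * R * ω (dist x₂ x₁ / R)

/-- Two sets `X, Y ⊆ ℝ^d` are bi-`ω` equivalent: there is a bijection `f : X → Y` such that
both `f` and `f⁻¹` are homogeneous `ω`-mappings. -/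
def BiOmegaEquiv {d : ℕ} (ω : ℝ → ℝ) (a : ℝ) (X Y : Set (Euc d)) : Prop :=
  ∃ f g : Euc d → Euc d, Set.BijOn f X Y ∧ Set.InvOn g f X Y ∧
    IsHomogeneousOmegaMap ω a X f ∧ IsHomogeneousOmegaMap ω a Y g

/-- If `2 * H - 1` consecutive vectors, none longer than `(1 + k) a`, nearly attain the total length
`2 H a` in direction `u`, for every member of a family, then some even-numbered step is close to
`a u` for most members of the family. -/
theorem exists_even_step_near {E τ : Type*} [NormedAddCommGroup E] [InnerProductSpace ℝ E]
    (T : Finset τ) (H : ℕ) (hH : 0 < H) (w : ℕ → τ → E) (u : E) (hu : ‖u‖ = 1) (a k : ℝ)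
    (ha : 0 < a) (hk : 0 < k) (hk1 : k ≤ 1)
    (hw : ∀ i < 2 * H - 1, ∀ t ∈ T, ‖w i t‖ ≤ (1 + k) * a)
    (hsum : ∀ t ∈ T, 2 * H * a - 2 * H * k * a ≤ ∑ i ∈ Finset.range (2 * H - 1), inner ℝ u (w i t)) :
    ∃ i < H, 16 * ((T.filter fun t => 129 * k * a ^ 2 < ‖w (2 * i) t - a • u‖ ^ 2).card : ℝ)
      ≤ T.card := by
  classical
  set δ : ℕ → τ → ℝ := fun i t => (1 + k) * a - inner ℝ u (w i t) with hδ
  have hδ0 : ∀ i < 2 * H - 1, ∀ t ∈ T, 0 ≤ δ i t := by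
    intro i hi t ht
    have := real_inner_le_norm u (w i t)
    rw [hu, one_mul] at this
    simp only [hδ]
    linarith [hw i hi t ht]
  have hδs : ∀ t ∈ T, ∑ i ∈ Finset.range H, δ (2 * i) t ≤ 4 * H * k * a := by
    intro t ht
    have h1 : ∑ i ∈ Finset.range H, δ (2 * i) t ≤ ∑ i ∈ Finset.range (2 * H - 1), δ i t := by
      rw [← Finset.sum_image (f := fun i => δ i t) (g := fun i => 2 * i) (s := Finset.range H)
        (by intro x _ y _ h; simpa using h)]
      apply Finset.sum_le_sum_of_subset_of_nonneg
      · intro i hi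
        simp only [Finset.mem_image, Finset.mem_range] at hi ⊢
        omega
      · intro i hi _
        exact hδ0 i (by simpa using hi) t ht
    have h2 : ∑ i ∈ Finset.range (2 * H - 1), δ i t =
        (2 * H - 1) * ((1 + k) * a) - ∑ i ∈ Finset.range (2 * H - 1), inner ℝ u (w i t) := by
      simp only [hδ, Finset.sum_sub_distrib, Finset.sum_const, Finset.card_range, nsmul_eq_mul]
      rw [Nat.cast_sub (by omega)]
      push_cast
      ring
    have h3 := hsum t ht
    have : 0 < k * a := by positivity
    nlinarith
  have hne : (Finset.range H).Nonempty := by simpa using hH.ne'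
  obtain ⟨i, hi, hle⟩ := Finset.exists_le_of_sum_le (s := Finset.range H)
    (f := fun i => ∑ t ∈ T, δ (2 * i) t) (g := fun _ => T.card * (4 * k * a)) hne (by
      rw [Finset.sum_comm]
      calc ∑ t ∈ T, ∑ i ∈ Finset.range H, δ (2 * i) t ≤ ∑ t ∈ T, 4 * H * k * a :=
            Finset.sum_le_sum hδs
        _ = _ := by simp; ring)
  have hiH : i < H := by simpa using hi
  refine ⟨i, hiH, ?_⟩
  set Bd := T.filter fun t => 129 * k * a ^ 2 < ‖w (2 * i) t - a • u‖ ^ 2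
  have hb : ∀ t ∈ Bd, 64 * k * a ≤ δ (2 * i) t := by
    intro t ht
    obtain ⟨htT, ht⟩ := Finset.mem_filter.1 ht
    by_contra! hlt
    have h1 := hw (2 * i) (by omega) t htT
    have h2 : ‖w (2 * i) t‖ ^ 2 ≤ ((1 + k) * a) ^ 2 := by gcongr
    have h3 : ‖w (2 * i) t - a • u‖ ^ 2 =
        ‖w (2 * i) t‖ ^ 2 - 2 * (a * inner ℝ u (w (2 * i) t)) + a ^ 2 := by
      rw [norm_sub_sq_real, inner_smul_right, norm_smul, hu, real_inner_comm]
      simp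
    simp only [hδ] at hlt
    have h5 : k * k ≤ k * 1 := by gcongr
    nlinarith [mul_le_mul_of_nonneg_right h5 (sq_nonneg a)]
  have hfin : (Bd.card : ℝ) * (64 * k * a) ≤ T.card * (4 * k * a) :=
    calc (Bd.card : ℝ) * (64 * k * a) = ∑ t ∈ Bd, 64 * k * a := by simp
      _ ≤ ∑ t ∈ Bd, δ (2 * i) t := Finset.sum_le_sum hb
      _ ≤ ∑ t ∈ T, δ (2 * i) t := by
        apply Finset.sum_le_sum_of_subset_of_nonneg (Finset.filter_subset _ _)
        intro t ht _
        exact hδ0 _ (by omega) t ht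
      _ ≤ _ := hle
  have hka : 0 < 4 * k * a := by positivity
  refine le_of_mul_le_mul_right ?_ hka
  linarith

theorem card_filter_Ico_near_ends {s b : ℤ} (hb : 0 ≤ b) :
    (((Finset.Ico 0 s).filter fun t => ¬ (b ≤ t ∧ t < s - b)).card : ℝ) ≤ 2 * b := by
  have h : ((Finset.Ico 0 s).filter fun t => ¬ (b ≤ t ∧ t < s - b)) ⊆
      Finset.Ico 0 b ∪ Finset.Ico (s - b) s := by
    intro t
    simp only [Finset.mem_filter, Finset.mem_Ico, Finset.mem_union]
    omega
  have h2 := (Finset.card_le_card h).trans (Finset.card_union_le _ _)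
  simp only [Int.card_Ico] at h2
  have h3 : (((Finset.Ico 0 s).filter fun t => ¬ (b ≤ t ∧ t < s - b)).card : ℤ) ≤ 2 * b := by
    omega
  exact_mod_cast h3

theorem card_filter_Ico_emod_lt {m g r : ℤ} (hg : 0 < g) (hm : 0 ≤ m) (hr : 0 ≤ r) :
    (((Finset.Ico 0 (m * g)).filter fun t => t % g < r).card : ℝ) ≤ m * r := by
  have h : ((Finset.Ico 0 (m * g)).filter fun t => t % g < r).card ≤
      (Finset.Ico 0 m ×ˢ Finset.Ico 0 r).card := by
    refine Finset.card_le_card_of_injOn (fun t => (t / g, t % g)) ?_ ?_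
    · intro t ht
      simp only [Finset.coe_filter, Finset.mem_Ico, Set.mem_ofPred_eq] at ht
      simp only [Finset.coe_product, Set.mem_prod, Finset.coe_Ico, Set.mem_Ico]
      exact ⟨⟨Int.ediv_nonneg ht.1.1 hg.le, Int.ediv_lt_of_lt_mul hg ht.1.2⟩,
        Int.emod_nonneg _ hg.ne', ht.2⟩
    · intro t _ t' _ h
      simp only [Prod.mk.injEq] at h
      rw [← Int.mul_ediv_add_emod t g, ← Int.mul_ediv_add_emod t' g, h.1, h.2]
  rw [Finset.card_product, Int.card_Ico, Int.card_Ico] at h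
  have h3 : (((Finset.Ico 0 (m * g)).filter fun t => t % g < r).card : ℤ) ≤ m * r := by
    calc _ ≤ (((m - 0).toNat * (r - 0).toNat : ℕ) : ℤ) := by exact_mod_cast h
      _ = _ := by push_cast; rw [Int.toNat_of_nonneg (by omega), Int.toNat_of_nonneg (by omega)]; ring
  exact_mod_cast h3

/-- The discrete cube `{0, …, s - 1}^d`. -/
def discreteCube (d : ℕ) (s : ℤ) : Finset (Fin d → ℤ) :=
  Fintype.piFinset fun _ => Finset.Ico 0 s

theorem mem_discreteCube {d : ℕ} {s : ℤ} {t : Fin d → ℤ} :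
    t ∈ discreteCube d s ↔ ∀ i, 0 ≤ t i ∧ t i < s := by
  simp [discreteCube]

theorem card_discreteCube_filter_le {d : ℕ} {s : ℤ} (hs : 0 ≤ s) (i : Fin d) (p : ℤ → Prop)
    [DecidablePred p] {c : ℝ} (h : (((Finset.Ico 0 s).filter p).card : ℝ) ≤ c * s) :
    (((discreteCube d s).filter fun t => p (t i)).card : ℝ) ≤ c * (discreteCube d s).card := by
  classical
  have h1 : ((discreteCube d s).filter fun t => p (t i)) =
      Fintype.piFinset (Function.update (fun _ => Finset.Ico 0 s) i ((Finset.Ico 0 s).filter p)) := by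
    ext t
    simp only [Finset.mem_filter, mem_discreteCube, Fintype.mem_piFinset]
    constructor
    · intro ht l
      by_cases hl : l = i
      · subst hl; simpa using ⟨ht.1 l, ht.2⟩
      · simpa [Function.update_of_ne hl] using ht.1 l
    · intro ht
      have hti := ht i
      simp only [Function.update_self, Finset.mem_filter, Finset.mem_Ico] at hti
      refine ⟨fun l => ?_, hti.2⟩
      by_cases hl : l = i
      · subst hl; exact hti.1
      · simpa [Function.update_of_ne hl] using ht l
  have h2 : ∀ S : Finset ℤ, (Fintype.piFinset (Function.update
      (fun _ : Fin d => Finset.Ico (0 : ℤ) s) i S)).card =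
      S.card * ∏ l ∈ Finset.univ.erase i, (Finset.Ico (0 : ℤ) s).card := by
    intro S
    rw [Fintype.card_piFinset, ← Finset.mul_prod_erase _ _ (Finset.mem_univ i)]
    congr 1
    · simp
    · exact Finset.prod_congr rfl fun l hl => by simp [Function.update_of_ne (Finset.ne_of_mem_erase hl)]
  have h3 : (discreteCube d s).card =
      (Finset.Ico (0 : ℤ) s).card * ∏ l ∈ Finset.univ.erase i, (Finset.Ico (0 : ℤ) s).card := by
    rw [← h2]; simp [discreteCube]
  have h4 : ((Finset.Ico (0 : ℤ) s).card : ℝ) = s := by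
    rw [Int.card_Ico, sub_zero]
    exact_mod_cast Int.toNat_of_nonneg hs
  rw [h1, h2, h3]
  push_cast [h4]
  rw [← mul_assoc]
  gcongr

/-- The side length of the tiles of the `j`-th checkerboard in the `n`-th region. -/
def tileSize (n j : ℕ) : ℤ := 2 ^ (n * (2 * j + 2))

/-- The spacing of the grid of marked points at level `j` in the `n`-th region. -/
def gridSize (n j : ℕ) : ℤ := 2 ^ (n * (2 * j + 1))

theorem tileSize_pos (n j : ℕ) : 0 < tileSize n j := by unfold tileSize; positivity

theorem gridSize_pos (n j : ℕ) : 0 < gridSize n j := by unfold gridSize; positivity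

theorem tileSize_eq (n j : ℕ) : tileSize n j = 2 ^ n * gridSize n j := by
  unfold tileSize gridSize; rw [← pow_add]; congr 1; ring

theorem gridSize_succ (n j : ℕ) : gridSize n (j + 1) = 2 ^ n * tileSize n j := by
  unfold tileSize gridSize; rw [← pow_add]; congr 1; ring

theorem tileSize_succ (n j : ℕ) : tileSize n (j + 1) = 2 ^ (2 * n) * tileSize n j := by
  rw [tileSize_eq, gridSize_succ]; ring

theorem two_pow_le_gridSize (n j : ℕ) : 2 ^ n ≤ gridSize n j := by
  unfold gridSize
  apply pow_le_pow_right₀ (by norm_num)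
  nlinarith

theorem tileSize_mono (n : ℕ) {i j : ℕ} (h : i ≤ j) : tileSize n i ≤ tileSize n j := by
  unfold tileSize
  apply pow_le_pow_right₀ (by norm_num)
  gcongr

theorem gridSize_dvd (n : ℕ) {i j : ℕ} (h : i ≤ j) : gridSize n i ∣ gridSize n j := by
  unfold gridSize
  apply pow_dvd_pow
  gcongr

theorem gridSize_dvd_tileSize (n : ℕ) {i j : ℕ} (h : i ≤ j) : gridSize n i ∣ tileSize n j := by
  rw [tileSize_eq]
  exact (gridSize_dvd n h).mul_left _

theorem two_dvd_gridSize {n : ℕ} (hn : 0 < n) (j : ℕ) : 2 ∣ gridSize n j := by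
  unfold gridSize
  exact dvd_pow_self _ (by positivity)

/-- The superposition of the checkerboards of levels `j < n`; the `j`-th one lives on parallel
strips of width `tileSize n j` and is overruled by the finer ones. -/
def Checker (n : ℕ) (a b : ℤ) : Prop :=
  ∃ j < n, b % gridSize n (j + 1) < tileSize n j ∧
    (∀ i < j, tileSize n i ≤ b % gridSize n (i + 1)) ∧ Odd (a / tileSize n j)

/-- Where the net contains all lattice points, in terms of the first two coordinates. -/
def IsDense (a b : ℤ) : Prop :=
  ∃ n, tileSize n n ≤ a ∧ a < 2 * tileSize n n ∧ Checker n a b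

/-- The lattice points with even first coordinate, together with all those in dense places. -/
def netPoints {d : ℕ} (i₀ i₁ : Fin d) : Set (Fin d → ℤ) :=
  {z | Even (z i₀) ∨ IsDense (z i₀) (z i₁)}

theorem two_mul_tileSize_diag_le {m n : ℕ} (h : m < n) : 2 * tileSize m m ≤ tileSize n n := by
  unfold tileSize
  rw [← pow_succ']
  apply pow_le_pow_right₀ (by norm_num)
  nlinarith

theorem isDense_iff {n j : ℕ} {a b : ℤ} (hj : j < n) (ha : tileSize n n ≤ a)
    (ha' : a < 2 * tileSize n n) (hb : b % gridSize n (j + 1) < tileSize n j)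
    (hb' : ∀ i < j, tileSize n i ≤ b % gridSize n (i + 1)) :
    IsDense a b ↔ Odd (a / tileSize n j) := by
  constructor
  · rintro ⟨m, hm, hm', l, hl, h1, h2, h3⟩
    have hmn : m = n := by
      rcases lt_trichotomy m n with h | h | h
      · have := two_mul_tileSize_diag_le h; omega
      · exact h
      · have := two_mul_tileSize_diag_le h; omega
    subst hmn
    rcases lt_trichotomy l j with h | h | h
    · exact absurd (hb' l h) (not_le.2 h1)
    · subst h; exact h3
    · exact absurd (h2 j h) (not_le.2 hb)
  · intro h
    exact ⟨n, ha, ha', j, hj, hb, hb', h⟩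

/-- Within a tile of level `j`, with `b` the second coordinate relative to a corner of the tile:
whether a finer checkerboard overrules the tile. -/
def Overruled (n j : ℕ) (b : ℤ) : Prop := ∃ i < j, b % gridSize n (i + 1) < tileSize n i

theorem isDense_tile_iff {n j : ℕ} (hj : j < n) {x₀ x₁ t₀ t₁ m : ℤ}
    (hx₀ : gridSize n (j + 1) ∣ x₀) (hx₁ : gridSize n (j + 1) ∣ x₁)
    (h0 : 0 ≤ t₀) (h0' : t₀ < tileSize n j) (h1 : 0 ≤ t₁) (h1' : t₁ < tileSize n j)
    (ha : tileSize n n ≤ x₀ + m * tileSize n j + t₀)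
    (ha' : x₀ + m * tileSize n j + t₀ < 2 * tileSize n n) (ht : ¬ Overruled n j t₁) :
    IsDense (x₀ + m * tileSize n j + t₀) (x₁ + t₁) ↔ Odd m := by
  have hs := tileSize_pos n j
  have hmod : ∀ i ≤ j, (x₁ + t₁) % gridSize n (i + 1) = t₁ % gridSize n (i + 1) := by
    intro i hi
    obtain ⟨c, hc⟩ := (gridSize_dvd n (by omega : i + 1 ≤ j + 1)).trans hx₁
    rw [hc, add_comm, Int.add_mul_emod_self_left]
  rw [isDense_iff hj ha ha']
  · obtain ⟨c, hc⟩ := hx₀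
    have hdiv : (x₀ + m * tileSize n j + t₀) / tileSize n j = 2 ^ n * c + m := by
      rw [hc, gridSize_succ]
      rw [show 2 ^ n * tileSize n j * c + m * tileSize n j + t₀ =
        t₀ + (2 ^ n * c + m) * tileSize n j by ring, Int.add_mul_ediv_right _ _ hs.ne',
        Int.ediv_eq_zero_of_lt h0 h0', zero_add]
    rw [hdiv]
    have he : Even ((2 : ℤ) ^ n * c) := by
      apply Even.mul_right
      exact (even_two.pow_of_ne_zero (by omega))
    rw [Int.odd_add]
    constructor
    · intro h
      by_contra h2
      exact (Int.not_odd_iff_even.2 he) (h.2 (Int.not_odd_iff_even.1 h2))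
    · intro h
      exact ⟨fun h3 => absurd h3 (Int.not_odd_iff_even.2 he),
        fun h3 => absurd h3 (Int.not_even_iff_odd.2 h)⟩
  · rw [hmod j le_rfl]
    refine lt_of_le_of_lt ?_ h1'
    have := Int.mul_ediv_add_emod t₁ (gridSize n (j + 1))
    have := mul_nonneg (gridSize_pos n (j + 1)).le
      (Int.ediv_nonneg h1 (gridSize_pos n (j + 1)).le)
    linarith
  · intro i hi
    rw [hmod i hi.le]
    by_contra! h
    exact ht ⟨i, hi, h⟩

theorem card_overruled_le {d n j : ℕ} (i : Fin d) [DecidablePred (Overruled n j)] (hj : j ≤ n)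
    (hn : 16 * n ≤ 2 ^ n) :
    16 * (((discreteCube d (tileSize n j)).filter fun t => Overruled n j (t i)).card : ℝ)
      ≤ (discreteCube d (tileSize n j)).card := by
  classical
  have hs := (tileSize_pos n j)
  have key : (((Finset.Ico 0 (tileSize n j)).filter (Overruled n j)).card : ℝ) ≤
      (1 / 16) * tileSize n j := by
    have hsub : (Finset.Ico 0 (tileSize n j)).filter (Overruled n j) ⊆
        (Finset.range j).biUnion fun l =>
          (Finset.Ico 0 (tileSize n j)).filter fun t => t % gridSize n (l + 1) < tileSize n l := by
      intro t ht
      obtain ⟨h1, l, hl, h2⟩ := Finset.mem_filter.1 ht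
      simp only [Finset.mem_biUnion, Finset.mem_range, Finset.mem_filter]
      exact ⟨l, hl, h1, h2⟩
    have hpow : (0 : ℝ) < 2 ^ n := by positivity
    have hl : ∀ l ∈ Finset.range j, (((Finset.Ico 0 (tileSize n j)).filter fun t =>
        t % gridSize n (l + 1) < tileSize n l).card : ℝ) ≤ tileSize n j / 2 ^ n := by
      intro l hl
      obtain ⟨m, hm⟩ := gridSize_dvd_tileSize n (i := l + 1) (j := j) (by simpa using hl)
      have hg := gridSize_pos n (l + 1)
      have hm0 : 0 ≤ m := by
        by_contra! h
        nlinarith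
      rw [mul_comm] at hm
      rw [hm]
      refine (card_filter_Ico_emod_lt hg hm0 (tileSize_pos n l).le).trans ?_
      rw [gridSize_succ, le_div_iff₀ hpow]
      push_cast
      apply le_of_eq
      ring
    have h1 : (((Finset.Ico 0 (tileSize n j)).filter (Overruled n j)).card : ℝ) ≤
        j * (tileSize n j / 2 ^ n) := by
      calc _ ≤ (((Finset.range j).biUnion fun l => (Finset.Ico 0 (tileSize n j)).filter fun t =>
            t % gridSize n (l + 1) < tileSize n l).card : ℝ) := by
              exact_mod_cast Finset.card_le_card hsub
        _ ≤ ∑ l ∈ Finset.range j, (((Finset.Ico 0 (tileSize n j)).filter fun t =>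
            t % gridSize n (l + 1) < tileSize n l).card : ℝ) := by
              exact_mod_cast Finset.card_biUnion_le
        _ ≤ ∑ l ∈ Finset.range j, ((tileSize n j : ℝ) / 2 ^ n) := Finset.sum_le_sum hl
        _ = _ := by simp
    refine h1.trans ?_
    have h16 : 16 * (j : ℝ) ≤ 2 ^ n := by
      have : 16 * j ≤ 2 ^ n := by omega
      exact_mod_cast this
    rw [mul_div_assoc', div_le_iff₀ hpow]
    have : (0 : ℝ) < tileSize n j := by exact_mod_cast hs
    nlinarith
  have := card_discreteCube_filter_le hs.le i (Overruled n j) key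
  linarith

theorem card_even_le {d n j : ℕ} (i : Fin d) (hn : 0 < n) {x : ℤ} (hx : Even x) :
    2 * (((discreteCube d (tileSize n j)).filter fun t => Even (x + t i)).card : ℝ)
      ≤ (discreteCube d (tileSize n j)).card := by
  classical
  have hs := (tileSize_pos n j)
  have h2 : 2 ∣ tileSize n j := (two_dvd_gridSize hn j).trans (gridSize_dvd_tileSize n le_rfl)
  obtain ⟨m, hm⟩ := h2
  have h := card_filter_Ico_emod_lt (m := m) (g := 2) (r := 1) (by norm_num) (by omega) (by norm_num)
  rw [mul_comm m 2, ← hm] at h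
  have hP : ∀ t : ℤ, Even (x + t) ↔ t % 2 < 1 := by
    intro t
    rw [Int.even_iff] at *
    omega
  have := card_discreteCube_filter_le hs.le i (fun t => t % 2 < 1) (c := 1 / 2) (by
    refine h.trans ?_
    rw [hm]; push_cast; linarith)
  simp only [hP]
  linarith

theorem card_near_boundary_le {d : ℕ} {s b : ℤ} (hs : 0 ≤ s) (hb : 0 ≤ b) (h : 32 * d * b ≤ s) :
    16 * (((discreteCube d s).filter fun t => ¬ ∀ i, b ≤ t i ∧ t i < s - b).card : ℝ)
      ≤ (discreteCube d s).card := by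
  classical
  rcases Nat.eq_zero_or_pos d with rfl | hd
  · simp
  have hh : 32 * (d : ℝ) * b ≤ s := by exact_mod_cast h
  have hsub : ((discreteCube d s).filter fun t => ¬ ∀ i, b ≤ t i ∧ t i < s - b) ⊆
      Finset.univ.biUnion fun i => (discreteCube d s).filter fun t => ¬ (b ≤ t i ∧ t i < s - b) := by
    intro t
    simp only [Finset.mem_filter, Finset.mem_biUnion, Finset.mem_univ, true_and, not_forall]
    rintro ⟨h1, i, hi⟩
    exact ⟨i, h1, hi⟩
  have hi : ∀ i : Fin d, (((discreteCube d s).filter fun t => ¬ (b ≤ t i ∧ t i < s - b)).card : ℝ)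
      ≤ 1 / (16 * d) * (discreteCube d s).card := by
    intro i
    refine card_discreteCube_filter_le hs i (fun t => ¬ (b ≤ t ∧ t < s - b)) ?_
    refine (card_filter_Ico_near_ends hb).trans ?_
    rw [div_mul_eq_mul_div, le_div_iff₀ (by positivity)]
    linarith
  have h1 : (((discreteCube d s).filter fun t => ¬ ∀ i, b ≤ t i ∧ t i < s - b).card : ℝ) ≤
      d * (1 / (16 * d) * (discreteCube d s).card) := by
    calc _ ≤ ((Finset.univ.biUnion fun i => (discreteCube d s).filter
            fun t => ¬ (b ≤ t i ∧ t i < s - b)).card : ℝ) := by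
              exact_mod_cast Finset.card_le_card hsub
      _ ≤ ∑ i : Fin d, (((discreteCube d s).filter
            fun t => ¬ (b ≤ t i ∧ t i < s - b)).card : ℝ) := by
              exact_mod_cast Finset.card_biUnion_le
      _ ≤ ∑ i : Fin d, 1 / (16 * d) * ((discreteCube d s).card : ℝ) :=
            Finset.sum_le_sum fun i _ => hi i
      _ = _ := by simp
  have : (d : ℝ) * (1 / (16 * d) * (discreteCube d s).card) = (discreteCube d s).card / 16 := by
    field_simp
  linarith

/-- A dense tile cannot be mapped injectively, by small displacements, into the adjacent sparse
tile. -/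
theorem not_shift_dense_tile {d : ℕ} {i₀ i₁ : Fin d} (hne : i₀ ≠ i₁) {E : Type*} [AddCommGroup E]
    {F : (Fin d → ℤ) → E} (hinj : InjOn F (netPoints i₀ i₁)) {n j : ℕ} (hj : j < n)
    (hn : 16 * n ≤ 2 ^ n) {m : ℤ} (hm : Even m) {x : Fin d → ℤ}
    (hx : ∀ i, gridSize n (j + 1) ∣ x i) (hlo : tileSize n n ≤ x i₀ + m * tileSize n j)
    (hhi : x i₀ + (m + 2) * tileSize n j ≤ 2 * tileSize n n) {b : ℤ} (hb : 0 ≤ b)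
    (hbs : 32 * d * b ≤ tileSize n j) (v : E) (good : (Fin d → ℤ) → Prop) [DecidablePred good]
    (hgood : 16 * (((discreteCube d (tileSize n j)).filter fun t => ¬ good t).card : ℝ) ≤
      (discreteCube d (tileSize n j)).card)
    (hshift : ∀ t ∈ discreteCube d (tileSize n j), good t →
      x + Pi.single i₀ ((m + 1) * tileSize n j) + t ∈ netPoints i₀ i₁ →
      ∃ p ∈ netPoints i₀ i₁, F p = F (x + Pi.single i₀ ((m + 1) * tileSize n j) + t) - v ∧
        ∀ i, |p i - (x + (Pi.single i₀ (m * tileSize n j) : Fin d → ℤ) + t : Fin d → ℤ) i| ≤ b) : False := by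
  classical
  set s := tileSize n j with hs
  have hs0 : 0 < s := tileSize_pos n j
  set T := discreteCube d s with hT
  have hTpos : 0 < T.card := by
    rw [Finset.card_pos]
    exact ⟨0, mem_discreteCube.2 fun i => ⟨le_rfl, hs0⟩⟩
  set Z := T.filter fun t => (∀ i, b ≤ t i ∧ t i < s - b) ∧ good t ∧ ¬ Overruled n j (t i₁) with hZ
  set W := T.filter fun t => Even (x i₀ + m * s + t i₀) ∨ Overruled n j (t i₁) with hW
  have hx0 : Even (x i₀ + m * s) := by
    have h1 : (2 : ℤ) ∣ x i₀ := (two_dvd_gridSize (by omega) _).trans (hx i₀)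
    exact (even_iff_two_dvd.2 h1).add (hm.mul_right _)
  have hZnet : ∀ t ∈ Z, x + Pi.single i₀ ((m + 1) * s) + t ∈ netPoints i₀ i₁ := by
    intro t ht
    obtain ⟨htT, -, -, hov⟩ := Finset.mem_filter.1 ht
    have hb := mem_discreteCube.1 htT
    right
    simp only [Pi.add_apply, Pi.single_eq_same, Pi.single_eq_of_ne hne.symm, add_zero]
    rw [isDense_tile_iff hj (hx _) (hx _) (hb i₀).1 (hb i₀).2 (hb i₁).1 (hb i₁).2 _ _ hov]
    · exact hm.add_one
    · have := (hb i₀).1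
      rw [← hs]
      linarith
    · have := (hb i₀).2
      rw [← hs]
      linarith
  have hchoice : ∀ t : Z, ∃ p ∈ netPoints i₀ i₁,
      F p = F (x + Pi.single i₀ ((m + 1) * s) + (t : Fin d → ℤ)) - v ∧
        ∀ i, |p i - (x + (Pi.single i₀ (m * s) : Fin d → ℤ) + (t : Fin d → ℤ) : Fin d → ℤ) i| ≤ b := fun t =>
    hshift t (Finset.mem_filter.1 t.2).1 (Finset.mem_filter.1 t.2).2.2.1 (hZnet t t.2)
  choose p hpnet hpF hpb using hchoice
  have hle : Z.card ≤ W.card := by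
    refine Finset.card_le_card_of_injective
      (f := fun t => (⟨p t - (x + Pi.single i₀ (m * s)), ?_⟩ : W)) ?_
    · have hd := (Finset.mem_filter.1 t.2).2.1
      have hmem : p t - (x + Pi.single i₀ (m * s)) ∈ T := by
        rw [mem_discreteCube]
        intro i
        have h1 := abs_le.1 (hpb t i)
        have h2 := hd i
        simp only [Pi.add_apply, Pi.sub_apply] at h1 ⊢
        constructor <;> linarith
      refine Finset.mem_filter.2 ⟨hmem, ?_⟩
      by_contra! hcon
      have hb := mem_discreteCube.1 hmem
      have h0 : p t i₀ = x i₀ + m * s + (p t - (x + (Pi.single i₀ (m * s) : Fin d → ℤ)) : Fin d → ℤ) i₀ := by simp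
      have h1 : p t i₁ = x i₁ + (p t - (x + (Pi.single i₀ (m * s) : Fin d → ℤ)) : Fin d → ℤ) i₁ := by
        simp [Pi.single_eq_of_ne hne.symm]
      rcases hpnet t with hev | hden
      · rw [h0] at hev
        exact hcon.1 hev
      · rw [h0, h1, isDense_tile_iff hj (hx _) (hx _) (hb i₀).1 (hb i₀).2 (hb i₁).1 (hb i₁).2
          _ _ hcon.2] at hden
        · exact Int.not_even_iff_odd.2 hden hm
        · have := (hb i₀).1
          linarith
        · have := (hb i₀).2
          linarith
    · intro t t' h
      simp only [Subtype.mk.injEq, sub_left_inj] at h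
      have h1 := hpF t
      rw [h, hpF t', sub_left_inj] at h1
      have h2 := hinj (hZnet t' t'.2) (hZnet t t.2) h1
      exact Subtype.ext (add_left_cancel h2).symm
  have hWle : 16 * (W.card : ℝ) ≤ 9 * T.card := by
    have h1 : W.card ≤ (T.filter fun t => Even (x i₀ + m * s + t i₀)).card +
        (T.filter fun t => Overruled n j (t i₁)).card := by
      rw [hW, Finset.filter_or]
      exact Finset.card_union_le _ _
    have h2 := card_even_le (j := j) i₀ (by omega : 0 < n) hx0
    have h3 := card_overruled_le i₁ hj.le hn
    have h1' : (W.card : ℝ) ≤ (T.filter fun t => Even (x i₀ + m * s + t i₀)).card +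
        (T.filter fun t => Overruled n j (t i₁)).card := by exact_mod_cast h1
    rw [← hs, ← hT] at h2 h3
    linarith
  have hZge : 13 * (T.card : ℝ) ≤ 16 * Z.card := by
    have h0 : T ⊆ Z ∪ ((T.filter fun t => ¬ ∀ i, b ≤ t i ∧ t i < s - b) ∪
        ((T.filter fun t => ¬ good t) ∪ T.filter fun t => Overruled n j (t i₁))) := by
      intro t ht
      simp only [hZ, Finset.mem_union, Finset.mem_filter]
      tauto
    have h1 := (Finset.card_le_card h0).trans (Finset.card_union_le _ _)
    have h2 := Finset.card_union_le (T.filter fun t => ¬ ∀ i, b ≤ t i ∧ t i < s - b)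
        ((T.filter fun t => ¬ good t) ∪ T.filter fun t => Overruled n j (t i₁))
    have h3 := Finset.card_union_le (T.filter fun t => ¬ good t)
      (T.filter fun t => Overruled n j (t i₁))
    have h4 : (T.card : ℝ) ≤ Z.card + ((T.filter fun t => ¬ ∀ i, b ≤ t i ∧ t i < s - b).card +
        ((T.filter fun t => ¬ good t).card + (T.filter fun t => Overruled n j (t i₁)).card)) := by
      exact_mod_cast (by omega)
    have h5 := card_near_boundary_le (d := d) hs0.le hb hbs
    have h6 := card_overruled_le i₁ hj.le hn
    rw [← hT] at h5
    rw [← hs, ← hT] at h6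
    linarith
  have h1 : (Z.card : ℝ) ≤ W.card := by exact_mod_cast hle
  have h2 : (0 : ℝ) < T.card := by exact_mod_cast hTpos
  linarith

theorem euc_norm_le_of_forall_abs_le {d : ℕ} {x : Euc d} {m : ℝ} (hm : 0 ≤ m)
    (h : ∀ i, |x i| ≤ m) : ‖x‖ ≤ d * m := by
  rcases Nat.eq_zero_or_pos d with rfl | hd
  · have : x = 0 := Subsingleton.elim _ _
    simp [this]
  have hd' : (1 : ℝ) ≤ d := by exact_mod_cast hd
  refine abs_le_of_sq_le_sq' ?_ (by positivity) |>.2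
  rw [EuclideanSpace.norm_sq_eq]
  calc ∑ i, ‖x i‖ ^ 2 ≤ ∑ _i : Fin d, m ^ 2 := by
        apply Finset.sum_le_sum
        intro i _
        rw [Real.norm_eq_abs]
        gcongr
        exact h i
    _ = d * m ^ 2 := by simp
    _ ≤ (d * m) ^ 2 := by
      rw [mul_pow]
      gcongr
      nlinarith

theorem exists_intLattice_norm_sub_le {d : ℕ} (y : Euc d) :
    ∃ v ∈ intLattice d, ‖v - y‖ ≤ d := by
  refine ⟨WithLp.toLp 2 fun i => (round (y i) : ℝ), fun i => ⟨round (y i), rfl⟩, ?_⟩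
  rw [← mul_one (d : ℝ)]
  apply euc_norm_le_of_forall_abs_le zero_le_one
  intro i
  have := abs_sub_round (y i)
  rw [abs_sub_comm] at this
  simp only [PiLp.sub_apply]
  linarith

/-- `F` behaves on the `n`-th region of the net like a `Λ`-bilipschitz bijection onto the integer
lattice. -/
structure IsRegionBilip {d : ℕ} (i₀ i₁ : Fin d) (n : ℕ) (Λ : ℝ) (F : (Fin d → ℤ) → Euc d) :
    Prop where
  lip : ∀ p ∈ netPoints i₀ i₁, ∀ q ∈ netPoints i₀ i₁,
    (∀ i, 0 ≤ p i ∧ p i ≤ 2 * tileSize n n) → (∀ i, 0 ≤ q i ∧ q i ≤ 2 * tileSize n n) →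
    ∀ m : ℝ, (∀ i, |(p i : ℝ) - q i| ≤ m) → ‖F p - F q‖ ≤ Λ * m
  inv : ∀ p ∈ netPoints i₀ i₁, (∀ i, 0 ≤ p i ∧ p i ≤ 2 * tileSize n n) →
    ∀ y ∈ intLattice d, ‖y - F p‖ ≤ tileSize n n →
    ∃ p' ∈ netPoints i₀ i₁, F p' = y ∧ ∀ i, |(p' i : ℝ) - p i| ≤ Λ * ‖y - F p‖
  inj : InjOn F (netPoints i₀ i₁)
  mem : ∀ p ∈ netPoints i₀ i₁, F p ∈ intLattice d

/-- The left end of a tube of level `j`. -/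
structure IsMarked {d : ℕ} (i₀ : Fin d) (n j : ℕ) (x : Fin d → ℤ) : Prop where
  dvd : ∀ i, gridSize n j ∣ x i
  bounds : ∀ i, 0 ≤ x i ∧ x i + tileSize n j ≤ 2 * tileSize n n
  le : tileSize n n ≤ x i₀

/-- The rate at which the stretch grows from one level to the next. -/
def stretchGain (d : ℕ) (Λ : ℝ) : ℝ := 1 / (129 * (128 * d) ^ 2 * Λ ^ 4)

section numerics

variable {d n : ℕ} {Λ : ℝ}

theorem stretchGain_pos (hd : 2 ≤ d) (hΛ : d ≤ Λ) : 0 < stretchGain d Λ := by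
  have hd' : (2 : ℝ) ≤ d := by exact_mod_cast hd
  have : 0 < Λ := by linarith
  unfold stretchGain
  positivity

theorem stretchGain_le_one (hd : 2 ≤ d) (hΛ : d ≤ Λ) : stretchGain d Λ ≤ 1 := by
  have hd' : (2 : ℝ) ≤ d := by exact_mod_cast hd
  have h1 : 1 ≤ Λ := by linarith
  have h2 : (1 : ℝ) ≤ 128 * d := by linarith
  unfold stretchGain
  rw [div_le_one (by positivity)]
  have := one_le_mul_of_one_le_of_one_le (one_le_pow₀ h2 (n := 2)) (one_le_pow₀ h1 (n := 4))
  linarith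

theorem two_mul_sq_le_stretchGain_mul (hd : 2 ≤ d) (hΛ : d ≤ Λ)
    (hbig : 129 * (128 * d) ^ 2 * Λ ^ 6 < n) (hn : 16 * n ≤ 2 ^ n) :
    2 * Λ ^ 2 ≤ 2 ^ (2 * n) * stretchGain d Λ := by
  have hd' : (2 : ℝ) ≤ d := by exact_mod_cast hd
  have h0 : 0 < Λ := by linarith
  have hn' : 16 * (n : ℝ) ≤ 2 ^ n := by exact_mod_cast hn
  unfold stretchGain
  rw [mul_one_div, le_div_iff₀ (by positivity)]
  have h1 : (1 : ℝ) ≤ 2 ^ n := one_le_pow₀ (by norm_num)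
  have h2 : (2 : ℝ) ^ (2 * n) = 2 ^ n * 2 ^ n := by rw [two_mul, pow_add]
  rw [h2]
  have h3 : (2 : ℝ) ^ n * 1 ≤ 2 ^ n * 2 ^ n := by gcongr
  have h4 : 2 * Λ ^ 2 * (129 * (128 * d) ^ 2 * Λ ^ 4) = 2 * (129 * (128 * (d : ℝ)) ^ 2 * Λ ^ 6) := by
    ring
  rw [h4]
  have : (0 : ℝ) ≤ n := by positivity
  linarith

theorem stretchGain_mul_sq_le (hd : 2 ≤ d) (hΛ : d ≤ Λ) {A : ℝ} (hA : 0 ≤ A) (hA' : A ≤ Λ) :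
    129 * stretchGain d Λ * A ^ 2 ≤ (1 / (128 * d * Λ)) ^ 2 := by
  have hd' : (2 : ℝ) ≤ d := by exact_mod_cast hd
  calc 129 * stretchGain d Λ * A ^ 2 ≤ 129 * stretchGain d Λ * Λ ^ 2 := by
        have := stretchGain_pos hd hΛ
        gcongr
    _ = (1 / (128 * d * Λ)) ^ 2 := by
      unfold stretchGain
      field_simp

theorem displacement_le (hd : 2 ≤ d) (hΛ : d ≤ Λ)
    (hbig : 129 * (128 * d) ^ 2 * Λ ^ 6 < n) (hn : 16 * n ≤ 2 ^ n) (j : ℕ) :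
    gridSize n j + Λ * (Λ * gridSize n j + tileSize n j * (1 / (128 * d * Λ)) + d) ≤
      2 * tileSize n j / (128 * d) := by
  have hd' : (2 : ℝ) ≤ d := by exact_mod_cast hd
  have h0 : 2 ≤ Λ := by linarith
  have hn' : 16 * (n : ℝ) ≤ 2 ^ n := by exact_mod_cast hn
  have hg : (1 : ℝ) ≤ gridSize n j := by exact_mod_cast gridSize_pos n j
  have hs : (tileSize n j : ℝ) = 2 ^ n * gridSize n j := by
    rw [tileSize_eq]; push_cast; ring
  have hq : 128 * d * (1 + 2 * Λ ^ 2) ≤ (2 : ℝ) ^ n := by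
    have h1 : (1 : ℝ) ≤ Λ ^ 4 := one_le_pow₀ (by linarith)
    have h3 : (4 : ℝ) ≤ Λ ^ 2 := by nlinarith
    have h5 : (128 * (d : ℝ)) * Λ ^ 2 ≤ (128 * d) ^ 2 * Λ ^ 2 := by
      gcongr; nlinarith
    have h6 : 128 * d * 1 ≤ 128 * d * Λ ^ 2 := by gcongr; linarith
    have : (0 : ℝ) ≤ n := by positivity
    nlinarith
  have e1 : Λ * (tileSize n j * (1 / (128 * d * Λ))) = tileSize n j / (128 * d) := by
    field_simp
  have h7 : gridSize n j * (1 + 2 * Λ ^ 2) ≤ (tileSize n j : ℝ) / (128 * d) := by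
    rw [le_div_iff₀ (by positivity), hs]
    nlinarith
  have h8 : Λ * d ≤ Λ ^ 2 * gridSize n j := by
    have : Λ * d ≤ Λ * Λ := by gcongr
    nlinarith [mul_le_mul_of_nonneg_left hg (sq_nonneg Λ)]
  have e2 : (2 * tileSize n j / (128 * d) : ℝ) = tileSize n j / (128 * d) + tileSize n j / (128 * d) := by
    ring
  rw [e2]
  linarith

theorem two_mul_tileSize_div_le (hd : 2 ≤ d) (hΛ : d ≤ Λ)
    (hbig : 129 * (128 * d) ^ 2 * Λ ^ 6 < n) (hn : 16 * n ≤ 2 ^ n) (j : ℕ) :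
    2 * (tileSize n j : ℝ) / (128 * d) ≤ ((tileSize n j / (32 * d) : ℤ) : ℝ) := by
  have hd' : (2 : ℝ) ≤ d := by exact_mod_cast hd
  have hn' : 16 * (n : ℝ) ≤ 2 ^ n := by exact_mod_cast hn
  have hs : (64 * d : ℝ) ≤ tileSize n j := by
    have h1 : (2 : ℝ) ^ n ≤ gridSize n j := by exact_mod_cast two_pow_le_gridSize n j
    have h2 : (tileSize n j : ℝ) = 2 ^ n * gridSize n j := by
      rw [tileSize_eq]; push_cast; ring
    have h3 : (1 : ℝ) ≤ 2 ^ n := one_le_pow₀ (by norm_num)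
    have h4 : (1 : ℝ) ≤ Λ ^ 6 := one_le_pow₀ (by linarith)
    nlinarith
  have hd0 : (0 : ℤ) < 32 * d := by omega
  have h := Int.lt_ediv_add_one_mul_self (tileSize n j) hd0
  have h' : (tileSize n j : ℝ) < (((tileSize n j / (32 * d) : ℤ) : ℝ) + 1) * (32 * d) := by
    exact_mod_cast h
  rw [div_le_iff₀ (by positivity)]
  nlinarith

end numerics

set_option maxHeartbeats 1000000 in
/-- If the ends of a tube are stretched, the ends of some tube of the next level are stretched even
more. -/
theorem IsRegionBilip.exists_more_stretched {d : ℕ} {i₀ i₁ : Fin d} (hne : i₀ ≠ i₁) {n : ℕ} {Λ : ℝ}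
    {F : (Fin d → ℤ) → Euc d} (hF : IsRegionBilip i₀ i₁ n Λ F) (hd : 2 ≤ d) (hΛ : d ≤ Λ)
    (hbig : 129 * (128 * d) ^ 2 * Λ ^ 6 < n) (hn : 16 * n ≤ 2 ^ n) {j : ℕ} (hj : j < n)
    {x : Fin d → ℤ} (hx : IsMarked i₀ n (j + 1) x) {A : ℝ} (hA : 1 ≤ Λ * A)
    (hst : A * tileSize n (j + 1) ≤ ‖F (x + Pi.single i₀ (tileSize n (j + 1))) - F x‖) :
    ∃ x', IsMarked i₀ n j x' ∧
      (1 + stretchGain d Λ) * A * tileSize n j ≤ ‖F (x' + Pi.single i₀ (tileSize n j)) - F x'‖ := by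
  classical
  by_contra! hcon
  have hd' : (2 : ℝ) ≤ d := by exact_mod_cast hd
  have hΛ0 : 0 < Λ := by linarith
  have hA0 : 0 < A := by
    by_contra! h
    nlinarith
  have hn0 : 0 < n := by omega
  have hk := stretchGain_pos hd hΛ
  set k := stretchGain d Λ with hkdef
  set s := tileSize n j with hs
  set γ := gridSize n j with hγ
  have hs0 : 0 < s := tileSize_pos n j
  have hγ0 : 0 < γ := gridSize_pos n j
  have hγs : γ ∣ s := gridSize_dvd_tileSize n le_rfl
  have hs0' : (0 : ℝ) < s := by exact_mod_cast hs0
  obtain ⟨H, hH⟩ : ∃ H : ℕ, 2 ^ (2 * n) = 2 * H := ⟨2 ^ (2 * n - 1), by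
    rw [← pow_succ']; congr 1; omega⟩
  have hHpos : 0 < H := by
    have : 0 < 2 ^ (2 * n) := by positivity
    omega
  have hHZ : (2 : ℤ) ^ (2 * n) = 2 * H := by exact_mod_cast hH
  have hHR : (2 : ℝ) ^ (2 * n) = 2 * H := by exact_mod_cast hH
  have hsucc : tileSize n (j + 1) = 2 * H * s := by rw [tileSize_succ, hHZ]
  have hγdvd : ∀ i, γ ∣ x i := fun i => (gridSize_dvd n (Nat.le_succ j)).trans (hx.dvd i)
  have hnet : ∀ z : Fin d → ℤ, γ ∣ z i₀ → z ∈ netPoints i₀ i₁ := fun z hz =>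
    Or.inl (even_iff_two_dvd.2 ((two_dvd_gridSize hn0 j).trans hz))
  have hxb := hx.bounds
  rw [hsucc] at hxb hst
  have hHs : ∀ i : ℕ, i ≤ 2 * H → 0 ≤ (i : ℤ) * s ∧ (i : ℤ) * s ≤ 2 * H * s := by
    intro i hi
    have : (i : ℤ) ≤ 2 * H := by exact_mod_cast hi
    exact ⟨by positivity, by gcongr⟩
  set T := discreteCube d s with hT
  set r : (Fin d → ℤ) → (Fin d → ℤ) := fun t l => γ * (t l / γ) with hr
  have hrle : ∀ t ∈ T, ∀ l, 0 ≤ r t l ∧ r t l ≤ t l ∧ t l < r t l + γ ∧ t l < s := by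
    intro t ht l
    have h1 := mem_discreteCube.1 ht l
    have h2 := Int.mul_ediv_add_emod (t l) γ
    have h3 := Int.emod_nonneg (t l) hγ0.ne'
    have h4 := Int.emod_lt_of_pos (t l) hγ0
    have h5 := mul_nonneg hγ0.le (Int.ediv_nonneg h1.1 hγ0.le)
    simp only [hr]
    refine ⟨h5, ?_, ?_, h1.2⟩ <;> linarith
  set P : ℕ → (Fin d → ℤ) → (Fin d → ℤ) := fun i t => x + Pi.single i₀ (i * s) + r t with hP
  have hPapp : ∀ i t l, P i t l = x l + (if l = i₀ then (i : ℤ) * s else 0) + r t l := by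
    intro i t l
    simp [hP, Pi.single_apply]
  have hPnet : ∀ i t, P i t ∈ netPoints i₀ i₁ := by
    intro i t
    apply hnet
    rw [hPapp, if_pos rfl]
    exact ((hγdvd _).add (hγs.mul_left _)).add (dvd_mul_right _ _)
  have hPQ : ∀ i < 2 * H, ∀ t ∈ T, ∀ l, 0 ≤ P i t l ∧ P i t l ≤ 2 * tileSize n n := by
    intro i hi t ht l
    have h1 := hrle t ht l
    have h2 := hxb l
    have h3 := (hHs i hi.le).1
    have h4 := (hHs (i + 1) hi).2
    have h5 := (hHs 1 (by omega)).2
    push_cast at h4 h5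
    rw [hPapp]
    split_ifs <;> constructor <;> linarith
  have hPmarked : ∀ i, i + 2 ≤ 2 * H → ∀ t ∈ T, IsMarked i₀ n j (P i t) := by
    intro i hi t ht
    refine ⟨fun l => ?_, fun l => ?_, ?_⟩
    · rw [hPapp]
      refine ((hγdvd _).add ?_).add (dvd_mul_right _ _)
      split_ifs
      · exact hγs.mul_left _
      · exact dvd_zero _
    · have h1 := hrle t ht l
      have h2 := hxb l
      have h3 := (hHs i (by omega)).1
      have h4 := (hHs (i + 2) hi).2
      have h5 := (hHs 2 (by omega)).2
      push_cast at h4 h5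
      rw [hPapp]
      split_ifs <;> constructor <;> linarith
    · have h1 := hrle t ht i₀
      have h3 := (hHs i (by omega)).1
      have h6 := hx.le
      rw [hPapp, if_pos rfl]
      linarith
  have hPsucc : ∀ i t, P i t + Pi.single i₀ s = P (i + 1) t := by
    intro i t
    ext l
    rw [Pi.add_apply, hPapp, hPapp, Pi.single_apply]
    push_cast
    split_ifs <;> ring
  set xe := x + Pi.single i₀ (2 * H * s) with hxe
  have hxeapp : ∀ l, xe l = x l + (if l = i₀ then 2 * (H : ℤ) * s else 0) := by
    intro l
    simp [hxe, Pi.single_apply]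
  have hxnet : x ∈ netPoints i₀ i₁ := hnet _ (hγdvd _)
  have hxenet : xe ∈ netPoints i₀ i₁ := by
    apply hnet
    rw [hxeapp, if_pos rfl]
    exact (hγdvd _).add (hγs.mul_left _)
  have hHs0 : 0 ≤ 2 * (H : ℤ) * s := by positivity
  have hxQ : ∀ l, 0 ≤ x l ∧ x l ≤ 2 * tileSize n n := by
    intro l
    have := hxb l
    constructor <;> linarith
  have hxeQ : ∀ l, 0 ≤ xe l ∧ xe l ≤ 2 * tileSize n n := by
    intro l
    have := hxb l
    rw [hxeapp]
    split_ifs <;> constructor <;> linarith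
  set U := F xe - F x with hU
  have hcast : ((2 * (H : ℤ) * s : ℤ) : ℝ) = 2 * H * s := by push_cast; ring
  rw [hcast] at hst
  have hUpos : 0 < ‖U‖ := lt_of_lt_of_le (by positivity) hst
  have hAΛ : A ≤ Λ := by
    have h1 := hF.lip xe hxenet x hxnet hxeQ hxQ (2 * H * s) (by
      intro l
      rw [hxeapp]
      push_cast
      split_ifs
      · rw [add_sub_cancel_left, abs_of_nonneg (by positivity)]
      · simp; positivity)
    have h2 := hst.trans h1
    exact le_of_mul_le_mul_right h2 (by positivity)
  set u : Euc d := (‖U‖⁻¹ : ℝ) • U with hu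
  have hu1 : ‖u‖ = 1 := by
    rw [hu, norm_smul, norm_inv, norm_norm, inv_mul_cancel₀ hUpos.ne']
  have huU : inner ℝ u U = ‖U‖ := by
    rw [hu, inner_smul_left, real_inner_self_eq_norm_sq]
    simp only [conj_trivial]
    field_simp
  set w : ℕ → (Fin d → ℤ) → Euc d := fun i t => F (P (i + 1) t) - F (P i t) with hw
  have hsumU : ∀ t ∈ T, ‖U‖ - 2 * Λ * s ≤ ∑ i ∈ Finset.range (2 * H - 1), inner ℝ u (w i t) := by
    intro t ht
    rw [← inner_sum]
    simp only [hw]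
    rw [Finset.sum_range_sub (fun i => F (P i t))]
    have h1 : ‖F xe - F (P (2 * H - 1) t)‖ ≤ Λ * s := by
      apply hF.lip _ hxenet _ (hPnet _ _) hxeQ (hPQ _ (by omega) t ht)
      intro l
      have h1 := hrle t ht l
      have h2 : |xe l - P (2 * H - 1) t l| ≤ s := by
        rw [hxeapp, hPapp, Nat.cast_sub (by omega), abs_le]
        push_cast
        split_ifs <;> constructor <;> linarith
      exact_mod_cast h2
    have h2 : ‖F (P 0 t) - F x‖ ≤ Λ * s := by
      apply hF.lip _ (hPnet _ _) _ hxnet (hPQ _ (by omega) t ht) hxQ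
      intro l
      have h1 := hrle t ht l
      have h2 : |P 0 t l - x l| ≤ s := by
        rw [hPapp, abs_le]
        push_cast
        split_ifs <;> constructor <;> linarith
      exact_mod_cast h2
    have h3 : F (P (2 * H - 1) t) - F (P 0 t) =
        U - (F xe - F (P (2 * H - 1) t)) - (F (P 0 t) - F x) := by
      rw [hU]; abel
    rw [h3, inner_sub_right, inner_sub_right, huU]
    have h4 := real_inner_le_norm u (F xe - F (P (2 * H - 1) t))
    have h5 := real_inner_le_norm u (F (P 0 t) - F x)
    rw [hu1, one_mul] at h4 h5
    linarith
  obtain ⟨i, hiH, hi⟩ := exists_even_step_near T H hHpos w u hu1 (A * s) k (by positivity) hk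
    (stretchGain_le_one hd hΛ) (by
      intro i hi t ht
      simp only [hw]
      rw [← hPsucc, ← mul_assoc]
      exact (hcon _ (hPmarked i (by omega) t ht)).le) (by
      intro t ht
      refine le_trans ?_ (hsumU t ht)
      have h1 := two_mul_sq_le_stretchGain_mul hd hΛ hbig hn
      rw [hHR, ← hkdef] at h1
      have h2 : 2 * Λ ≤ 2 * H * k * A := by
        have h3 : 2 * Λ ^ 2 * A ≤ 2 * H * k * A := by gcongr
        nlinarith
      nlinarith)
  obtain ⟨v, hv, hva⟩ := exists_intLattice_norm_sub_le ((A * s) • u)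
  have hgoodw : ∀ t, ¬ 129 * k * (A * s) ^ 2 < ‖w (2 * i) t - (A * s) • u‖ ^ 2 →
      ‖w (2 * i) t - (A * s) • u‖ ≤ s * (1 / (128 * d * Λ)) := by
    intro t ht
    refine abs_le_of_sq_le_sq' ?_ (by positivity) |>.2
    have h1 := stretchGain_mul_sq_le hd hΛ hA0.le hAΛ
    rw [← hkdef] at h1
    have h2 := mul_le_mul_of_nonneg_right h1 (sq_nonneg (s : ℝ))
    rw [mul_pow (s : ℝ)]
    rw [not_lt, mul_pow] at ht
    linarith
  have h2i : 2 * i + 1 < 2 * H := by omega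
  refine not_shift_dense_tile hne hF.inj hj hn (m := 2 * i) (even_two_mul _) hx.dvd
    ?_ ?_ (b := s / (32 * d)) (Int.ediv_nonneg hs0.le (by positivity)) (Int.mul_ediv_self_le (by omega)) v
    (fun t => ¬ 129 * k * (A * s) ^ 2 < ‖w (2 * i) t - (A * s) • u‖ ^ 2)
    (by simpa only [not_not] using hi) ?_
  · have h3 := (hHs (2 * i) (by omega)).1
    have h6 := hx.le
    push_cast at h3
    linarith
  · have h4 := (hHs (2 * i + 2) (by omega)).2
    have h2 := hxb i₀
    push_cast at h4
    linarith
  intro t ht hgood hznet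
  set z := x + Pi.single i₀ ((2 * (i : ℤ) + 1) * tileSize n j) + t with hz
  have hzapp : ∀ l, z l = P (2 * i + 1) t l + (t l - r t l) := by
    intro l
    rw [hPapp, hz]
    simp only [Pi.add_apply, Pi.single_apply]
    push_cast
    ring
  have hzQ : ∀ l, 0 ≤ z l ∧ z l ≤ 2 * tileSize n n := by
    intro l
    have h1 := hrle t ht l
    have h2 := hxb l
    have h3 := (hHs (2 * i + 1) (by omega)).1
    have h4 := (hHs (2 * i + 2) (by omega)).2
    have h5 := (hHs 1 (by omega)).2
    push_cast at h3 h4 h5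
    rw [hzapp, hPapp]
    push_cast
    split_ifs <;> constructor <;> linarith
  have h1 : ‖F z - F (P (2 * i + 1) t)‖ ≤ Λ * γ := by
    apply hF.lip _ hznet _ (hPnet _ _) hzQ (hPQ _ h2i t ht)
    intro l
    have h1 := hrle t ht l
    have h2 : |z l - P (2 * i + 1) t l| ≤ γ := by
      rw [hzapp, abs_le]
      constructor <;> linarith
    exact_mod_cast h2
  have hy : ‖F z - v - F (P (2 * i) t)‖ ≤ Λ * γ + s * (1 / (128 * d * Λ)) + d := by
    have h2 : F z - v - F (P (2 * i) t) = (F z - F (P (2 * i + 1) t)) +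
        (w (2 * i) t - (A * s) • u) - (v - (A * s) • u) := by
      simp only [hw]; abel
    rw [h2]
    refine (norm_sub_le _ _).trans (add_le_add ((norm_add_le _ _).trans ?_) hva)
    exact add_le_add h1 (hgoodw t hgood)
  have hdisp := displacement_le hd hΛ hbig hn j
  rw [← hs, ← hγ] at hdisp
  have hyB : ‖F z - v - F (P (2 * i) t)‖ ≤ tileSize n n := by
    have h2 : ((s : ℤ) : ℝ) ≤ tileSize n n := by exact_mod_cast tileSize_mono n hj.le
    have h3 : 2 * (s : ℝ) / (128 * d) ≤ s := by
      rw [div_le_iff₀ (by positivity)]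
      nlinarith
    have h4 : (0 : ℝ) < γ := by exact_mod_cast hγ0
    have h5 : 0 ≤ Λ * γ + s * (1 / (128 * d * Λ)) + d := by positivity
    have h6 := le_mul_of_one_le_left h5 (by linarith : (1 : ℝ) ≤ Λ)
    linarith
  have hymem : F z - v ∈ intLattice d := by
    intro l
    obtain ⟨a, ha⟩ := hF.mem z hznet l
    obtain ⟨b, hb⟩ := hv l
    exact ⟨a - b, by rw [PiLp.sub_apply, ha, hb]; push_cast; ring⟩
  obtain ⟨p, hp, hpF, hpd⟩ := hF.inv (P (2 * i) t) (hPnet _ _) (hPQ _ (by omega) t ht) _ hymem hyB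
  refine ⟨p, hp, hpF, fun l => ?_⟩
  have h2 : |(p l : ℝ) - P (2 * i) t l| ≤ Λ * (Λ * γ + s * (1 / (128 * d * Λ)) + d) :=
    (hpd l).trans (by gcongr)
  have h3 := two_mul_tileSize_div_le hd hΛ hbig hn j
  rw [← hs] at h3
  have h4 : |(P (2 * i) t l : ℝ) - (x + (Pi.single i₀ (2 * (i : ℤ) * s) : Fin d → ℤ) + t : Fin d → ℤ) l|
      ≤ γ := by
    have h1 := hrle t ht l
    have h2 : |P (2 * i) t l - (x + (Pi.single i₀ (2 * (i : ℤ) * s) : Fin d → ℤ) + t : Fin d → ℤ) l|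
        ≤ γ := by
      rw [hPapp, abs_le]
      simp only [Pi.add_apply, Pi.single_apply]
      push_cast
      constructor <;> linarith
    exact_mod_cast h2
  have h5 := (abs_sub_le _ _ _).trans (add_le_add h2 h4)
  have h6 := h5.trans ((by linarith : _ ≤ _) : _ ≤ ((s / (32 * d) : ℤ) : ℝ))
  exact_mod_cast h6

theorem not_isRegionBilip {d : ℕ} {i₀ i₁ : Fin d} (hne : i₀ ≠ i₁) {n : ℕ} {Λ : ℝ}
    {F : (Fin d → ℤ) → Euc d} (hd : 2 ≤ d) (hΛ : d ≤ Λ)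
    (hbig : 129 * (128 * d) ^ 2 * Λ ^ 6 < n) (hn : 16 * n ≤ 2 ^ n) :
    ¬ IsRegionBilip i₀ i₁ n Λ F := by
  intro hF
  have hd' : (2 : ℝ) ≤ d := by exact_mod_cast hd
  have hΛ0 : 0 < Λ := by linarith
  have hk := stretchGain_pos hd hΛ
  set k := stretchGain d Λ with hkdef
  have hn0 : 0 < n := by
    by_contra! h
    have : n = 0 := by omega
    subst this
    have : (0 : ℝ) ≤ 129 * (128 * d) ^ 2 * Λ ^ 6 := by positivity
    simp only [Nat.cast_zero] at hbig
    linarith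
  have hmnet : ∀ j x, IsMarked i₀ n j x → x ∈ netPoints i₀ i₁ ∧
      x + Pi.single i₀ (tileSize n j) ∈ netPoints i₀ i₁ := by
    intro j x hx
    have h1 := (two_dvd_gridSize hn0 j).trans (hx.dvd i₀)
    have h2 := (two_dvd_gridSize hn0 j).trans (gridSize_dvd_tileSize n (le_refl j))
    refine ⟨Or.inl (even_iff_two_dvd.2 h1), Or.inl (even_iff_two_dvd.2 ?_)⟩
    simpa using h1.add h2
  have hmQ : ∀ j x, IsMarked i₀ n j x → (∀ i, 0 ≤ x i ∧ x i ≤ 2 * tileSize n n) ∧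
      ∀ i, 0 ≤ (x + (Pi.single i₀ (tileSize n j) : Fin d → ℤ) : Fin d → ℤ) i ∧
        (x + (Pi.single i₀ (tileSize n j) : Fin d → ℤ) : Fin d → ℤ) i ≤ 2 * tileSize n n := by
    intro j x hx
    have hs := tileSize_pos n j
    refine ⟨fun i => ?_, fun i => ?_⟩
    · have := hx.bounds i
      constructor <;> linarith
    · have := hx.bounds i
      simp only [Pi.add_apply, Pi.single_apply]
      split_ifs <;> constructor <;> linarith
  have main : ∀ m ≤ n, ∃ x, IsMarked i₀ n (n - m) x ∧
      (1 + k) ^ m * (1 / Λ) * tileSize n (n - m) ≤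
        ‖F (x + Pi.single i₀ (tileSize n (n - m))) - F x‖ := by
    intro m
    induction m with
    | zero =>
      intro _
      have hB := tileSize_pos n n
      have hB' : (0 : ℝ) < tileSize n n := by exact_mod_cast hB
      have hx : IsMarked i₀ n n (Pi.single i₀ (tileSize n n)) := by
        refine ⟨fun i => ?_, fun i => ?_, by simp⟩
        · rw [Pi.single_apply]
          split_ifs
          · exact gridSize_dvd_tileSize n le_rfl
          · exact dvd_zero _
        · rw [Pi.single_apply]
          split_ifs <;> constructor <;> linarith
      refine ⟨_, hx, ?_⟩
      rw [pow_zero, one_mul, Nat.sub_zero, one_div, inv_mul_le_iff₀ hΛ0]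
      set x : Fin d → ℤ := Pi.single i₀ (tileSize n n) with hxdef
      set y := F (x + Pi.single i₀ (tileSize n n)) with hy
      have hne := hmnet n x hx
      by_cases hyB : ‖y - F x‖ ≤ tileSize n n
      · obtain ⟨p, hp, hpF, hpd⟩ := hF.inv x hne.1 (hmQ n x hx).1 y (hF.mem _ hne.2) hyB
        have := hF.inj hp hne.2 hpF
        subst this
        refine le_trans ?_ (hpd i₀)
        simp only [Pi.add_apply, Pi.single_eq_same]
        push_cast
        rw [add_sub_cancel_left]
        exact le_abs_self _
      · push Not at hyB
        nlinarith
    | succ m ih =>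
      intro hm
      obtain ⟨x, hx, hst⟩ := ih (by omega)
      obtain ⟨j, hj⟩ : ∃ j, j = n - (m + 1) := ⟨_, rfl⟩
      have hj1 : n - m = j + 1 := by omega
      rw [← hj]
      rw [hj1] at hx hst
      have h1 : 1 ≤ Λ * ((1 + k) ^ m * (1 / Λ)) := by
        rw [mul_one_div, mul_div_cancel₀ _ hΛ0.ne']
        exact one_le_pow₀ (by linarith)
      obtain ⟨x', hx', hst'⟩ := hF.exists_more_stretched hne hd hΛ hbig hn (by omega) hx h1 hst
      refine ⟨x', hx', le_trans (le_of_eq ?_) hst'⟩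
      rw [← hkdef]
      ring
  obtain ⟨x, hx, hst⟩ := main n le_rfl
  rw [Nat.sub_self] at hx hst
  have hs : (0 : ℝ) < tileSize n 0 := by exact_mod_cast tileSize_pos n 0
  have h1 := hF.lip _ (hmnet 0 x hx).2 _ (hmnet 0 x hx).1 (hmQ 0 x hx).2 (hmQ 0 x hx).1
    (tileSize n 0) (by
      intro i
      simp only [Pi.add_apply, Pi.single_apply]
      split_ifs
      · push_cast
        rw [add_sub_cancel_left, abs_of_pos hs]
      · simpa using hs.le)
  have h2 : (1 + k) ^ n * (1 / Λ) ≤ Λ := le_of_mul_le_mul_right (hst.trans h1) hs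
  rw [mul_one_div, div_le_iff₀ hΛ0] at h2
  have h3 := one_add_mul_le_pow (by linarith : (-2 : ℝ) ≤ k) n
  have h4 : Λ * Λ < n * k := by
    rw [hkdef, stretchGain, mul_one_div, lt_div_iff₀ (by positivity)]
    linarith
  linarith

/-- The embedding of the lattice points in Euclidean space. -/
def latticePoint {d : ℕ} (z : Fin d → ℤ) : Euc d := WithLp.toLp 2 fun i => (z i : ℝ)

theorem latticePoint_apply {d : ℕ} (z : Fin d → ℤ) (i : Fin d) : latticePoint z i = z i := rfl

theorem latticePoint_injective {d : ℕ} : Function.Injective (latticePoint (d := d)) := by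
  intro p q h
  ext i
  have := congrArg (fun x : Euc d => x i) h
  simpa [latticePoint_apply] using this

theorem euc_abs_apply_le_norm {d : ℕ} (x : Euc d) (i : Fin d) : |x i| ≤ ‖x‖ := by
  simpa using PiLp.norm_apply_le x i

theorem one_le_dist_of_mem_intLattice {d : ℕ} {x y : Euc d} (hx : x ∈ intLattice d)
    (hy : y ∈ intLattice d) (hxy : x ≠ y) : 1 ≤ dist x y := by
  obtain ⟨i, hi⟩ : ∃ i, x i ≠ y i := by
    by_contra! h
    exact hxy (PiLp.ext h)
  obtain ⟨a, ha⟩ := hx i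
  obtain ⟨b, hb⟩ := hy i
  rw [dist_eq_norm]
  refine le_trans ?_ (euc_abs_apply_le_norm _ i)
  rw [PiLp.sub_apply, ha, hb]
  rw [ha, hb] at hi
  have h1 : a - b ≠ 0 := fun h => hi (by rw [sub_eq_zero.1 h])
  exact_mod_cast Int.one_le_abs h1

theorem latticePoint_mem {d : ℕ} (z : Fin d → ℤ) : latticePoint z ∈ intLattice d :=
  fun i => ⟨z i, rfl⟩

theorem dist_latticePoint_le {d : ℕ} {p q : Fin d → ℤ} {m : ℝ} (hm : 0 ≤ m)
    (h : ∀ i, |(p i : ℝ) - q i| ≤ m) : dist (latticePoint p) (latticePoint q) ≤ d * m := by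
  rw [dist_eq_norm]
  exact euc_norm_le_of_forall_abs_le hm h

theorem isSeparatedNet_netPoints {d : ℕ} (i₀ i₁ : Fin d) :
    IsSeparatedNet (latticePoint '' netPoints i₀ i₁) := by
  have hd : 0 < d := i₀.pos
  refine ⟨1, d, one_pos, by exact_mod_cast hd, ?_, ?_⟩
  · rintro _ ⟨p, -, rfl⟩ _ ⟨q, -, rfl⟩ h
    exact one_le_dist_of_mem_intLattice (latticePoint_mem p) (latticePoint_mem q) h
  · intro z
    refine ⟨latticePoint fun i => 2 * round (z i / 2), ⟨_, Or.inl (even_two_mul _), rfl⟩, ?_⟩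
    rw [dist_eq_norm, ← mul_one (d : ℝ)]
    apply euc_norm_le_of_forall_abs_le zero_le_one
    intro i
    have h := abs_le.1 (abs_sub_round (z i / 2))
    rw [PiLp.sub_apply, latticePoint_apply, abs_le]
    push_cast
    constructor <;> linarith

theorem mul_log_rpow_le {α K R D : ℝ} (hα : 0 < α) (hK : 0 < K) (hR : 0 < R) (hD : 1 ≤ D)
    (hDR : D / R < 1 / 2) :
    K * R * (D / R * Real.log (1 / (D / R)) ^ α) ≤ K * Real.log R ^ α * D := by
  have hD0 : 0 < D := by linarith
  have hDR' : D ≤ R := by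
    rw [div_lt_iff₀ hR] at hDR
    linarith
  have h1 : K * R * (D / R * Real.log (1 / (D / R)) ^ α) = K * Real.log (R / D) ^ α * D := by
    rw [one_div_div]
    field_simp
  rw [h1]
  have h2 : 0 ≤ Real.log (R / D) := Real.log_nonneg (by rwa [le_div_iff₀ hD0, one_mul])
  have h3 : Real.log (R / D) ≤ Real.log R :=
    Real.log_le_log (by positivity) (div_le_self hR.le hD)
  gcongr

theorem log_mul_tileSize_le {c : ℝ} {n : ℕ} (hc : 0 < c) (hcn : c ≤ 8 * n) (hn : 5 ≤ n) :
    Real.log (c * tileSize n n) ≤ (n : ℝ) ^ 3 := by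
  have hB : (0 : ℝ) < tileSize n n := by exact_mod_cast tileSize_pos n n
  have hn' : (5 : ℝ) ≤ n := by exact_mod_cast hn
  rw [Real.log_mul hc.ne' hB.ne']
  have h1 : Real.log c ≤ c := (Real.log_le_sub_one_of_pos hc).trans (by linarith)
  have h2 : Real.log (tileSize n n : ℝ) ≤ n * (2 * n + 2) := by
    unfold tileSize
    push_cast
    rw [Real.log_pow]
    push_cast
    have h3 : Real.log 2 ≤ 1 := (Real.log_le_sub_one_of_pos two_pos).trans (by norm_num)
    exact mul_le_of_le_one_right (by positivity) h3
  nlinarith [mul_nonneg (by linarith : (0 : ℝ) ≤ n - 5) (sq_nonneg (n : ℝ))]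

theorem isRegionBilip_of_isHomogeneous {d : ℕ} (i₀ i₁ : Fin d) {α a K₁ K₂ : ℝ} (hα : 0 < α)
    (ha : a = 1 / 2)
    {f g : Euc d → Euc d} (hf : BijOn f (latticePoint '' netPoints i₀ i₁) (intLattice d))
    (hg : InvOn g f (latticePoint '' netPoints i₀ i₁) (intLattice d)) (hK₁ : 0 < K₁) (hK₂ : 0 < K₂)
    (hf' : ∀ R : ℝ, 0 < R → ∀ x₁ ∈ (latticePoint '' netPoints i₀ i₁) ∩ ball 0 R,
      ∀ x₂ ∈ (latticePoint '' netPoints i₀ i₁) ∩ ball 0 R,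
      0 < dist x₂ x₁ / R → dist x₂ x₁ / R < a →
      dist (f x₂) (f x₁) ≤ K₁ * R * (dist x₂ x₁ / R * Real.log (1 / (dist x₂ x₁ / R)) ^ α))
    (hg' : ∀ R : ℝ, 0 < R → ∀ x₁ ∈ intLattice d ∩ ball 0 R, ∀ x₂ ∈ intLattice d ∩ ball 0 R,
      0 < dist x₂ x₁ / R → dist x₂ x₁ / R < a →
      dist (g x₂) (g x₁) ≤ K₂ * R * (dist x₂ x₁ / R * Real.log (1 / (dist x₂ x₁ / R)) ^ α))
    {n : ℕ} {Λ : ℝ} (hΛ : 2 ≤ Λ) (hf0 : ‖f 0‖ ≤ tileSize n n)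
    (h₁ : K₁ * Real.log (8 * d * tileSize n n) ^ α * d ≤ Λ)
    (h₂ : K₂ * Real.log (8 * Λ * tileSize n n) ^ α ≤ Λ) :
    IsRegionBilip i₀ i₁ n Λ (fun z => f (latticePoint z)) := by
  subst ha
  have hd : (0 : ℝ) < d := by exact_mod_cast i₀.pos
  have hB : (0 : ℝ) < tileSize n n := by exact_mod_cast tileSize_pos n n
  have hnorm : ∀ p q : Fin d → ℤ, (∀ i, 0 ≤ p i ∧ p i ≤ 2 * tileSize n n) →
      (∀ i, 0 ≤ q i ∧ q i ≤ 2 * tileSize n n) →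
      dist (latticePoint p) (latticePoint q) ≤ d * (2 * tileSize n n) := by
    intro p q hp hq
    apply dist_latticePoint_le (by positivity)
    intro i
    have h : |p i - q i| ≤ 2 * tileSize n n := by
      have := hp i
      have := hq i
      rw [abs_le]
      constructor <;> linarith
    exact_mod_cast h
  have h0 : latticePoint (0 : Fin d → ℤ) = 0 := by
    ext i
    simp [latticePoint_apply]
  have hQ0 : ∀ i : Fin d, 0 ≤ (0 : Fin d → ℤ) i ∧ (0 : Fin d → ℤ) i ≤ 2 * tileSize n n := by
    intro i
    have := tileSize_pos n n
    simp only [Pi.zero_apply]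
    constructor <;> linarith
  have hnet0 : (0 : Fin d → ℤ) ∈ netPoints i₀ i₁ := Or.inl (by simp)
  have hlip : ∀ p ∈ netPoints i₀ i₁, ∀ q ∈ netPoints i₀ i₁,
      (∀ i, 0 ≤ p i ∧ p i ≤ 2 * tileSize n n) → (∀ i, 0 ≤ q i ∧ q i ≤ 2 * tileSize n n) →
      ∀ m : ℝ, (∀ i, |(p i : ℝ) - q i| ≤ m) →
      ‖f (latticePoint p) - f (latticePoint q)‖ ≤ Λ * m := by
    intro p hp q hq hpQ hqQ m hm
    have hm0 : 0 ≤ m := (abs_nonneg _).trans (hm i₀)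
    rcases eq_or_ne p q with rfl | hpq
    · simp only [sub_self, norm_zero]
      positivity
    have hD := one_le_dist_of_mem_intLattice (latticePoint_mem p) (latticePoint_mem q)
      (latticePoint_injective.ne hpq)
    have hR : 0 < 8 * d * (tileSize n n : ℝ) := by positivity
    have hball : ∀ p : Fin d → ℤ, (∀ i, 0 ≤ p i ∧ p i ≤ 2 * tileSize n n) →
        latticePoint p ∈ ball (0 : Euc d) (8 * d * (tileSize n n : ℝ)) := by
      intro p hp
      have := hnorm p 0 hp hQ0
      rw [h0] at this
      rw [mem_ball]
      nlinarith [mul_pos hd hB]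
    have hDR : dist (latticePoint p) (latticePoint q) / (8 * d * (tileSize n n : ℝ)) < 1 / 2 := by
      rw [div_lt_iff₀ hR]
      have := hnorm p q hpQ hqQ
      nlinarith [mul_pos hd hB]
    have h3 := hf' _ hR (latticePoint q) ⟨mem_image_of_mem _ hq, hball q hqQ⟩ (latticePoint p)
      ⟨mem_image_of_mem _ hp, hball p hpQ⟩ (by positivity) hDR
    rw [← dist_eq_norm]
    refine (h3.trans (mul_log_rpow_le hα hK₁ hR hD hDR)).trans ?_
    have hlog : 0 ≤ Real.log (8 * d * (tileSize n n : ℝ)) := by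
      apply Real.log_nonneg
      rw [div_lt_iff₀ hR] at hDR
      linarith
    calc _ ≤ K₁ * Real.log (8 * d * tileSize n n) ^ α * (d * m) := by
          gcongr
          exact dist_latticePoint_le hm0 hm
      _ = K₁ * Real.log (8 * d * tileSize n n) ^ α * d * m := by ring
      _ ≤ Λ * m := by gcongr
  have hmem : ∀ p ∈ netPoints i₀ i₁, f (latticePoint p) ∈ intLattice d :=
    fun p hp => hf.mapsTo (mem_image_of_mem _ hp)
  refine ⟨hlip, ?_, ?_, hmem⟩
  · intro p hp hpQ y hy hyB
    rcases eq_or_ne y (f (latticePoint p)) with rfl | hne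
    · exact ⟨p, hp, rfl, by simp⟩
    obtain ⟨_, ⟨p', hp', rfl⟩, rfl⟩ := hf.surjOn hy
    refine ⟨p', hp', rfl, ?_⟩
    have hR : 0 < 8 * Λ * (tileSize n n : ℝ) := by positivity
    have hΛB : 2 * (tileSize n n : ℝ) ≤ Λ * tileSize n n := by gcongr
    have hpn : ‖f (latticePoint p)‖ ≤ tileSize n n + Λ * (2 * tileSize n n) := by
      have h3 := hlip p hp 0 hnet0 hpQ hQ0 (2 * tileSize n n) (by
        intro i
        have h : |p i - 0| ≤ 2 * tileSize n n := by
          have := hpQ i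
          rw [abs_le]
          constructor <;> linarith
        exact_mod_cast h)
      rw [h0] at h3
      have h4 := norm_le_norm_add_norm_sub (f 0) (f (latticePoint p))
      rw [norm_sub_rev] at h4
      linarith
    have hyn := norm_le_norm_add_norm_sub (f (latticePoint p)) (f (latticePoint p'))
    rw [norm_sub_rev] at hyn
    have hD := one_le_dist_of_mem_intLattice hy (hmem p hp) hne
    have hDR : dist (f (latticePoint p')) (f (latticePoint p)) / (8 * Λ * (tileSize n n : ℝ)) < 1 / 2 := by
      rw [div_lt_iff₀ hR, dist_eq_norm]
      linarith
    have h3 := hg' _ hR (f (latticePoint p)) ⟨hmem p hp, by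
        rw [mem_ball_zero_iff]; linarith⟩ (f (latticePoint p')) ⟨hy, by
        rw [mem_ball_zero_iff]; linarith⟩ (by positivity) hDR
    rw [hg.1 (mem_image_of_mem _ hp'), hg.1 (mem_image_of_mem _ hp)] at h3
    have h4 := h3.trans (mul_log_rpow_le hα hK₂ hR hD hDR)
    intro i
    have h5 := euc_abs_apply_le_norm (latticePoint p' - latticePoint p) i
    rw [← dist_eq_norm] at h5
    refine (h5.trans h4).trans ?_
    rw [dist_eq_norm]
    gcongr
  · intro p hp q hq h
    exact latticePoint_injective (hf.injOn (mem_image_of_mem _ hp) (mem_image_of_mem _ hq) h)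

/-- The Lipschitz constant up to which the `n`-th region of the net prevents equivalence with the
lattice. -/
def regionBound (d n : ℕ) : ℝ := ((n : ℝ) / (2 * (129 * (128 * d) ^ 2))) ^ (1 / 6 : ℝ)

theorem tendsto_regionBound_atTop {d : ℕ} (hd : 0 < d) :
    Tendsto (regionBound d) atTop atTop := by
  unfold regionBound
  refine (tendsto_rpow_atTop (by norm_num)).comp ?_
  exact tendsto_natCast_atTop_atTop.atTop_div_const (by positivity)

theorem mul_regionBound_pow {d n : ℕ} (hd : 0 < d) :
    129 * (128 * (d : ℝ)) ^ 2 * regionBound d n ^ 6 = n / 2 := by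
  unfold regionBound
  set c : ℝ := 129 * (128 * (d : ℝ)) ^ 2 with hc
  have hc0 : 0 < c := by positivity
  have h : (((n : ℝ) / (2 * c)) ^ (1 / 6 : ℝ)) ^ 6 = (n : ℝ) / (2 * c) := by
    rw [← Real.rpow_natCast, ← Real.rpow_mul (by positivity)]
    norm_num
  rw [h]
  field_simp

theorem eventually_mul_rpow_le_regionBound {d : ℕ} (hd : 0 < d) (C : ℝ) :
    ∀ᶠ n : ℕ in atTop, C * ((n : ℝ) ^ 3) ^ (1 / 24 : ℝ) ≤ regionBound d n := by
  set c : ℝ := 2 * (129 * (128 * d) ^ 2) with hc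
  have hc0 : 0 < c := by positivity
  have h1 : Tendsto (fun n : ℕ => (n : ℝ) ^ (1 / 24 : ℝ)) atTop atTop :=
    (tendsto_rpow_atTop (by norm_num)).comp tendsto_natCast_atTop_atTop
  filter_upwards [h1.eventually_ge_atTop (C * c ^ (1 / 6 : ℝ)), eventually_gt_atTop 0] with n hn hn0
  have hn0' : (0 : ℝ) < n := by exact_mod_cast hn0
  unfold regionBound
  rw [← hc, Real.div_rpow hn0'.le hc0.le, le_div_iff₀ (by positivity), ← Real.rpow_natCast,
    ← Real.rpow_mul hn0'.le]
  have h2 : (n : ℝ) ^ (1 / 6 : ℝ) = (n : ℝ) ^ (1 / 24 : ℝ) * (n : ℝ) ^ ((3 : ℕ) * (1 / 24) : ℝ) := by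
    rw [← Real.rpow_add hn0']
    norm_num
  rw [h2]
  calc _ = C * c ^ (1 / 6 : ℝ) * (n : ℝ) ^ ((3 : ℕ) * (1 / 24) : ℝ) := by ring
    _ ≤ _ := by gcongr

theorem sixteen_mul_le_two_pow {n : ℕ} (hn : 7 ≤ n) : 16 * n ≤ 2 ^ n := by
  induction n, hn using Nat.le_induction with
  | base => norm_num
  | succ n hn ih => rw [pow_succ]; omega

/-- For `d ≥ 2` there are `α₀ > 0`, `a ∈ (0,1)` and a separated net
`X ⊆ ℝ^d` which is not bi-`ω` equivalent to the integer lattice `ℤ^d`, where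
`ω(t) = t (log (1/t))^{α₀}` on `(0, a)`. -/
theorem statement_0 (d : ℕ) (hd : 2 ≤ d) :
    ∃ α₀ : ℝ, 0 < α₀ ∧ ∃ a : ℝ, 0 < a ∧ a < 1 ∧
      ∃ X : Set (Euc d), IsSeparatedNet X ∧
        ¬ BiOmegaEquiv (fun t : ℝ => t * (Real.log (1/t)) ^ α₀) a X (intLattice d) := by
  let i₀ : Fin d := ⟨0, by omega⟩
  let i₁ : Fin d := ⟨1, by omega⟩
  have hne : i₀ ≠ i₁ := by simp [i₀, i₁]
  refine ⟨1 / 24, by norm_num, 1 / 2, by norm_num, by norm_num, latticePoint '' netPoints i₀ i₁,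
    isSeparatedNet_netPoints i₀ i₁, ?_⟩
  rintro ⟨f, g, hf, hg, ⟨K₁, hK₁, hf'⟩, ⟨K₂, hK₂, hg'⟩⟩
  have hd0 : 0 < d := by omega
  have hd' : (2 : ℝ) ≤ d := by exact_mod_cast hd
  obtain ⟨n, hΛd, hn1, hn2, hn7, hnd, hnf⟩ :=
    (((tendsto_regionBound_atTop hd0).eventually_ge_atTop (d : ℝ)).and <|
      (eventually_mul_rpow_le_regionBound hd0 (K₁ * d)).and <|
      (eventually_mul_rpow_le_regionBound hd0 K₂).and <|
      (eventually_ge_atTop 7).and <| (eventually_ge_atTop d).and <|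
      (tendsto_natCast_atTop_atTop.eventually_ge_atTop ‖f 0‖)).exists
  set Λ := regionBound d n with hΛ
  have hΛ2 : 2 ≤ Λ := hd'.trans hΛd
  have hpow := mul_regionBound_pow (n := n) hd0
  rw [← hΛ] at hpow
  have hn0 : (0 : ℝ) < n := by
    have : (7 : ℝ) ≤ n := by exact_mod_cast hn7
    linarith
  have hbig : 129 * (128 * (d : ℝ)) ^ 2 * Λ ^ 6 < n := by rw [hpow]; linarith
  have hB1 : (1 : ℝ) ≤ tileSize n n := by exact_mod_cast tileSize_pos n n
  have hΛn : Λ ≤ n := by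
    have h1 : Λ ≤ Λ ^ 6 := le_self_pow₀ (by linarith) (by norm_num)
    have h2 : 1 * Λ ^ 6 ≤ 129 * (128 * (d : ℝ)) ^ 2 * Λ ^ 6 := by
      gcongr
      nlinarith
    linarith
  have hlog : ∀ c : ℝ, 0 < c → c ≤ 8 * n → 1 ≤ c →
      Real.log (c * tileSize n n) ^ (1 / 24 : ℝ) ≤ ((n : ℝ) ^ 3) ^ (1 / 24 : ℝ) := by
    intro c hc hcn hc1
    refine Real.rpow_le_rpow (Real.log_nonneg ?_) (log_mul_tileSize_le hc hcn (by omega))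
      (by norm_num)
    nlinarith
  refine not_isRegionBilip hne hd hΛd hbig (sixteen_mul_le_two_pow hn7)
    (isRegionBilip_of_isHomogeneous i₀ i₁ (by norm_num) rfl hf hg hK₁ hK₂ hf' hg' hΛ2 ?_ ?_ ?_)
  · refine hnf.trans ?_
    have h1 : (n : ℤ) ≤ 2 ^ n := by exact_mod_cast Nat.lt_two_pow_self.le
    have h2 := (two_pow_le_gridSize n n)
    have h3 := Int.le_of_dvd (tileSize_pos n n) (gridSize_dvd_tileSize n (le_refl n))
    exact_mod_cast h1.trans (h2.trans h3)
  · refine le_trans ?_ hn1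
    have := hlog (8 * d) (by positivity) (by linarith) (by linarith)
    calc _ = K₁ * d * Real.log (8 * d * tileSize n n) ^ (1 / 24 : ℝ) := by ring
      _ ≤ _ := by gcongr
  · refine le_trans ?_ hn2
    have := hlog (8 * Λ) (by positivity) (by linarith) (by linarith)
    gcongr
end
end

section
/- Let d ≥ 2. Then there exist α₀ > 0 and a separated net X ⊆ ℝ^d such that every bijection f : X → ℤ^d satisfies limsup_{R→∞} biLip(f|_{X ∩ B(0,R)}) / (log R)^{α₀} = ∞. -/
open MeasureTheory Metric Set Filter

noncomputable section

/-- The point of `ℝ^d` with the given integer coordinates. -/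
def lat {d : ℕ} (x : Fin d → ℤ) : Euc d := WithLp.toLp 2 fun i => (x i : ℝ)

/-- Side length of the cubes in the level `j` chessboard. -/
@[irreducible] def side (j : ℕ) : ℤ := 2 ^ (j ^ 2 + 5 * j + 1)

/-- Distance between consecutive slabs carrying the level `j` chessboard. -/
@[irreducible] def gap (j : ℕ) : ℤ := 2 ^ (j ^ 2 + 6 * j + 7)

/-- The slabs carrying the level `j` chessboard. -/
def InSlab {d : ℕ} (i₁ : Fin d) (j : ℕ) (p : Fin d → ℤ) : Prop := p i₁ % gap j < side j

/-- The points of the white cubes. A slab of lower level overrides those of higher levels. -/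
def IsWhite {d : ℕ} (i₀ i₁ : Fin d) (p : Fin d → ℤ) : Prop :=
  ∃ j, InSlab i₁ j p ∧ (∀ i < j, ¬ InSlab i₁ i p) ∧ Even (p i₀ / side j)

/-- Integer coordinates of the net: all integer points with even `i₀`-th coordinate, and all
integer points of the white cubes. -/
def net {d : ℕ} (i₀ i₁ : Fin d) : Set (Fin d → ℤ) := {p | Even (p i₀) ∨ IsWhite i₀ i₁ p}

/-- The integer points of the cube `[0, c)^d`. -/
def cube (d : ℕ) (c : ℤ) : Finset (Fin d → ℤ) := Fintype.piFinset fun _ => Finset.Ico 0 c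

/-- Decrease the `i₀`-th coordinate to an even number. -/
def evenFloor {d : ℕ} (i₀ : Fin d) (q : Fin d → ℤ) : Fin d → ℤ := q - Pi.single i₀ (q i₀ % 2)

section Lattice

variable {d : ℕ}

lemma lat_injective : Function.Injective (lat (d := d)) := by
  intro x y h
  ext i
  have := congrArg (fun v : Euc d => v i) h
  simpa [lat] using this

lemma lat_mem_intLattice (x : Fin d → ℤ) : lat x ∈ intLattice d := fun i => ⟨x i, rfl⟩

lemma exists_lat_eq {v : Euc d} (hv : v ∈ intLattice d) : ∃ x, lat x = v := by
  choose x hx using hv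
  exact ⟨x, by ext i; simp [lat, hx]⟩

lemma norm_le_sum_abs (v : Euc d) : ‖v‖ ≤ ∑ i, |v i| := by
  rw [EuclideanSpace.norm_eq]
  refine Real.sqrt_le_iff.2 ⟨Finset.sum_nonneg fun i _ => abs_nonneg _, ?_⟩
  simp only [Real.norm_eq_abs]
  exact Finset.sum_sq_le_sq_sum_of_nonneg fun i _ => abs_nonneg _

lemma norm_le_of_abs_le {v : Euc d} {B : ℝ} (h : ∀ i, |v i| ≤ B) : ‖v‖ ≤ d * B := by
  refine (norm_le_sum_abs v).trans ((Finset.sum_le_sum fun i _ => h i).trans ?_)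
  simp

lemma dist_lat_le {x y : Fin d → ℤ} {B : ℤ} (h : ∀ i, |x i - y i| ≤ B) :
    dist (lat x) (lat y) ≤ d * B := by
  rw [dist_eq_norm]
  refine norm_le_of_abs_le fun i => ?_
  have := h i
  simp only [lat, PiLp.sub_apply]
  exact_mod_cast this

lemma norm_lat_le {x : Fin d → ℤ} {B : ℤ} (h : ∀ i, |x i| ≤ B) : ‖lat x‖ ≤ d * B := by
  refine norm_le_of_abs_le fun i => ?_
  have := h i
  simp only [lat]
  exact_mod_cast this

lemma abs_sub_le_dist_lat (x y : Fin d → ℤ) (i : Fin d) :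
    ((|x i - y i| : ℤ) : ℝ) ≤ dist (lat x) (lat y) := by
  rw [dist_eq_norm]
  have := PiLp.norm_apply_le (lat x - lat y) i
  simpa [lat] using this

lemma one_le_dist_lat {x y : Fin d → ℤ} (h : x ≠ y) : 1 ≤ dist (lat x) (lat y) := by
  obtain ⟨i, hi⟩ := Function.ne_iff.1 h
  refine le_trans ?_ (abs_sub_le_dist_lat x y i)
  exact_mod_cast Int.one_le_abs (sub_ne_zero.2 hi)

lemma dist_lat_add_single (x : Fin d → ℤ) (i : Fin d) (t : ℤ) :
    dist (lat (x + Pi.single i t)) (lat x) = |(t : ℝ)| := by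
  have : lat (x + Pi.single i t) - lat x = EuclideanSpace.single i (t : ℝ) := by
    ext j
    by_cases hj : j = i
    · subst hj; simp [lat]
    · simp [lat, hj]
  rw [dist_eq_norm, this]
  simp

lemma exists_lat_near (v : Euc d) : ∃ x : Fin d → ℤ, ‖lat x - v‖ ≤ d := by
  refine ⟨fun i => round (v i), ?_⟩
  have : ‖lat (fun i => round (v i)) - v‖ ≤ d * (1 / 2 : ℝ) := by
    refine norm_le_of_abs_le fun i => ?_
    simp only [lat, PiLp.sub_apply]
    rw [abs_sub_comm]
    exact abs_sub_round _
  have hd : (0 : ℝ) ≤ d := d.cast_nonneg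
  linarith

end Lattice

section Scales

lemma side_pos (j : ℕ) : 0 < side j := by unfold side; positivity

lemma gap_pos (j : ℕ) : 0 < gap j := by unfold gap; positivity

lemma gap_eq (j : ℕ) : gap j = side j * 2 ^ (j + 6) := by
  rw [gap, side, ← pow_add]; ring_nf

lemma side_succ (j : ℕ) : side (j + 1) = gap j * 2 ^ j := by
  rw [gap, side, ← pow_add]; ring_nf

lemma even_side (j : ℕ) : Even (side j) := by
  rw [side]; exact even_two.pow_of_ne_zero (by positivity)

lemma side_le_gap (j : ℕ) : side j ≤ gap j := by
  rw [gap_eq]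
  exact le_mul_of_one_le_right (side_pos j).le (one_le_pow₀ (by norm_num))

lemma gap_le_side_succ (j : ℕ) : gap j ≤ side (j + 1) := by
  rw [side_succ]
  exact le_mul_of_one_le_right (gap_pos j).le (one_le_pow₀ (by norm_num))

lemma two_side_le_side_succ (j : ℕ) : 2 * side j ≤ side (j + 1) := by
  refine le_trans ?_ (gap_le_side_succ j)
  have h : (2 : ℤ) ≤ 2 ^ (j + 6) := le_self_pow₀ (by norm_num) (by omega)
  rw [gap_eq]
  nlinarith [side_pos j]

lemma two_pow_le_side (j : ℕ) : (2 : ℤ) ^ j ≤ side j := by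
  rw [side]
  exact pow_le_pow_right₀ (by norm_num) (by nlinarith)

lemma gap_dvd_gap {i j : ℕ} (h : i ≤ j) : gap i ∣ gap j := by
  rw [gap, gap]
  exact pow_dvd_pow 2 (by gcongr)

lemma gap_dvd_side {i j : ℕ} (h : i < j) : gap i ∣ side j := by
  obtain ⟨k, rfl⟩ := Nat.exists_eq_add_of_lt h
  rw [gap, side]
  exact pow_dvd_pow 2 (by nlinarith)

end Scales

section Counting

variable {d : ℕ}

lemma mem_cube {c : ℤ} {q : Fin d → ℤ} : q ∈ cube d c ↔ ∀ t, 0 ≤ q t ∧ q t < c := by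
  simp [cube]

lemma card_cube {c : ℤ} (hc : 0 ≤ c) : ((cube d c).card : ℝ) = (c : ℝ) ^ d := by
  have : (c.toNat : ℝ) = (c : ℝ) := by exact_mod_cast Int.toNat_of_nonneg hc
  simp [cube, this]

lemma card_filter_emod_lt_le {g m a : ℤ} (hg : 0 < g) (hm : 0 ≤ m) (ha : 0 ≤ a) :
    (((Finset.Ico 0 (g * m)).filter fun t => t % g < a).card : ℝ) ≤ m * a := by
  have h : ((Finset.Ico 0 (g * m)).filter fun t => t % g < a).card ≤
      (Finset.Ico 0 m ×ˢ Finset.Ico 0 a).card := by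
    refine Finset.card_le_card_of_injOn (fun t => (t / g, t % g)) ?_ ?_
    · intro t ht
      simp only [Finset.coe_filter, Finset.mem_Ico, Set.mem_ofPred_eq] at ht
      simp only [Finset.coe_product, Finset.coe_Ico, Set.mem_prod, Set.mem_Ico]
      exact ⟨⟨Int.ediv_nonneg ht.1.1 hg.le, Int.ediv_lt_of_lt_mul hg (by linarith [ht.1.2])⟩,
        Int.emod_nonneg _ hg.ne', ht.2⟩
    · intro s _ t _ hst
      simp only [Prod.mk.injEq] at hst
      rw [← Int.mul_ediv_add_emod s g, ← Int.mul_ediv_add_emod t g, hst.1, hst.2]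
  have h1 : (m.toNat : ℝ) = m := by exact_mod_cast Int.toNat_of_nonneg hm
  have h2 : (a.toNat : ℝ) = a := by exact_mod_cast Int.toNat_of_nonneg ha
  calc _ ≤ ((Finset.Ico 0 m ×ˢ Finset.Ico 0 a).card : ℝ) := by exact_mod_cast h
    _ = m * a := by simp [h1, h2]

lemma card_cube_filter_le {c g a : ℤ} (hc : 0 < c) (hg : 0 < g) (hgc : g ∣ c) (ha : 0 ≤ a)
    (i : Fin d) :
    (((cube d c).filter fun q => q i % g < a).card : ℝ) ≤ a / g * (c : ℝ) ^ d := by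
  obtain ⟨m, rfl⟩ := hgc
  have hm : 0 ≤ m := (pos_of_mul_pos_right hc hg.le).le
  set s : Finset ℤ := (Finset.Ico 0 (g * m)).filter fun t => t % g < a with hs
  have hsub : ((cube d (g * m)).filter fun q => q i % g < a) ⊆
      Fintype.piFinset fun t => if t = i then s else Finset.Ico 0 (g * m) := by
    intro q hq
    rw [Finset.mem_filter, mem_cube] at hq
    rw [Fintype.mem_piFinset]
    intro t
    split_ifs with h
    · subst h; simp [hs, hq.1 t, hq.2]
    · simp [hq.1 t]
  have hcard := Finset.card_le_card hsub
  rw [Fintype.card_piFinset, ← Finset.mul_prod_erase _ _ (Finset.mem_univ i), if_pos rfl,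
    Finset.prod_congr rfl (g := fun _ => (g * m).toNat) (by
      intro t ht
      rw [if_neg (Finset.ne_of_mem_erase ht)]
      simp)] at hcard
  rw [Finset.prod_const, Finset.card_erase_of_mem (Finset.mem_univ i), Finset.card_univ,
    Fintype.card_fin] at hcard
  have hd : d - 1 + 1 = d := Nat.sub_add_cancel i.pos
  have h1 : ((g * m).toNat : ℝ) = (g : ℝ) * m := by
    exact_mod_cast Int.toNat_of_nonneg hc.le
  have hg' : (0 : ℝ) < g := by exact_mod_cast hg
  have hm' : (0 : ℝ) ≤ m := by exact_mod_cast hm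
  calc _ ≤ ((s.card * (g * m).toNat ^ (d - 1) : ℕ) : ℝ) := by exact_mod_cast hcard
    _ = s.card * ((g : ℝ) * m) ^ (d - 1) := by push_cast [h1]; rfl
    _ ≤ (m * a) * ((g : ℝ) * m) ^ (d - 1) := by
        gcongr
        exact card_filter_emod_lt_le hg hm ha
    _ = a / g * (((g * m : ℤ) : ℝ)) ^ d := by
        conv_rhs => rw [← hd, pow_succ]
        push_cast
        field_simp

open scoped Classical in
/-- The lower level slabs occupy a small part of each cube. -/
lemma card_lower_slabs_le (i₁ : Fin d) (j : ℕ) :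
    (((cube d (side j)).filter fun q => ∃ i < j, InSlab i₁ i q).card : ℝ) ≤
      (side j : ℝ) ^ d / 32 := by
  have hsub : ((cube d (side j)).filter fun q => ∃ i < j, InSlab i₁ i q) ⊆
      (Finset.range j).biUnion fun i => (cube d (side j)).filter fun q => q i₁ % gap i < side i := by
    intro q hq
    simp only [Finset.mem_filter, Finset.mem_biUnion, Finset.mem_range] at hq ⊢
    obtain ⟨hq, i, hi, h⟩ := hq
    exact ⟨i, hi, hq, h⟩
  have h1 := (Finset.card_le_card hsub).trans Finset.card_biUnion_le
  have hc : (0 : ℝ) < side j := by exact_mod_cast side_pos j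
  have hgeom : ∑ i ∈ Finset.range j, (1 / 2 : ℝ) ^ i ≤ 2 := by
    have := summable_geometric_two.sum_le_tsum (Finset.range j) fun i _ => by positivity
    rwa [tsum_geometric_two] at this
  calc _ ≤ ∑ i ∈ Finset.range j,
        (((cube d (side j)).filter fun q => q i₁ % gap i < side i).card : ℝ) := by
        exact_mod_cast h1
    _ ≤ ∑ i ∈ Finset.range j, (1 / 2 : ℝ) ^ i * ((side j : ℝ) ^ d / 64) := by
        refine Finset.sum_le_sum fun i hi => ?_
        refine (card_cube_filter_le (side_pos j) (gap_pos i) (gap_dvd_side (Finset.mem_range.1 hi))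
          (side_pos i).le i₁).trans (le_of_eq ?_)
        have : (side i : ℝ) ≠ 0 := by exact_mod_cast (side_pos i).ne'
        rw [gap_eq]
        push_cast
        rw [pow_add, one_div, inv_pow]
        field_simp
        norm_num
    _ ≤ 2 * ((side j : ℝ) ^ d / 64) := by
        rw [← Finset.sum_mul]
        gcongr
    _ = _ := by ring

/-- Only few points of a cube are close to its boundary. -/
lemma card_cube_boundary_le {c D : ℤ} (hc : 0 < c) (hD : 0 ≤ D) (hDc : 32 * d * D ≤ c) (hd : 0 < d) :
    (((cube d c).filter fun q => ¬ ∀ t, D ≤ q t ∧ q t < c - D).card : ℝ) ≤ (c : ℝ) ^ d / 16 := by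
  have hd1 : (1 : ℤ) ≤ d := by exact_mod_cast hd
  have hc2 : 2 * D ≤ c := by nlinarith
  have hc0 : 0 ≤ c := hc.le
  have hint : (cube d c).filter (fun q => ∀ t, D ≤ q t ∧ q t < c - D) =
      Fintype.piFinset fun _ => Finset.Ico D (c - D) := by
    ext q
    simp only [Finset.mem_filter, mem_cube, Fintype.mem_piFinset, Finset.mem_Ico]
    exact ⟨fun h => h.2, fun h => ⟨fun t => ⟨by linarith [h t], by linarith [h t]⟩, h⟩⟩
  have hsum := Finset.card_filter_add_card_filter_not (s := cube d c)
    (fun q => ∀ t, D ≤ q t ∧ q t < c - D)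
  rw [hint] at hsum
  have hsum' := congrArg (Nat.cast (R := ℝ)) hsum
  have h1 : ((c - D - D).toNat : ℝ) = (c : ℝ) - D - D := by
    exact_mod_cast Int.toNat_of_nonneg (by linarith : 0 ≤ c - D - D)
  rw [Nat.cast_add, card_cube hc0] at hsum'
  simp only [Fintype.card_piFinset, Int.card_Ico, Finset.prod_const, Finset.card_univ,
    Fintype.card_fin, Nat.cast_pow, h1] at hsum'
  have hc' : (0 : ℝ) < c := by exact_mod_cast hc
  have hb := one_add_mul_le_pow (a := -(2 * D / c : ℝ)) (by
    have : (2 * D / c : ℝ) ≤ 1 := by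
      rw [div_le_one hc']; exact_mod_cast hc2
    linarith) d
  have h2 : ((c : ℝ) - D - D) ^ d = (1 + -(2 * D / c : ℝ)) ^ d * (c : ℝ) ^ d := by
    rw [← mul_pow]
    congr 1
    field_simp
    ring
  have h3 : (d : ℝ) * (2 * D / c) ≤ 1 / 16 := by
    rw [mul_div_assoc', div_le_iff₀ hc']
    have : (32 * d * D : ℝ) ≤ c := by exact_mod_cast hDc
    linarith
  have h4 : (1 - 1 / 16 : ℝ) * (c : ℝ) ^ d ≤ ((c : ℝ) - D - D) ^ d := by
    rw [h2]
    gcongr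
    linarith
  linarith

end Counting

section Coloring

variable {d : ℕ} {i₀ i₁ : Fin d} {j : ℕ} {b q : Fin d → ℤ}

lemma inSlab_add_iff (hb : gap j ∣ b i₁) {i : ℕ} (hi : i ≤ j) :
    InSlab i₁ i (b + q) ↔ InSlab i₁ i q := by
  obtain ⟨k, hk⟩ := (gap_dvd_gap hi).trans hb
  rw [InSlab, InSlab, Pi.add_apply, hk, Int.mul_add_emod_self_left]

lemma inSlab_of_mem_cube (hq : q ∈ cube d (side j)) : InSlab i₁ j q := by
  have := mem_cube.1 hq i₁
  rw [InSlab, Int.emod_eq_of_lt this.1 (this.2.trans_le (side_le_gap j))]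
  exact this.2

lemma ediv_side_of_mem_cube (hq : q ∈ cube d (side j)) (k : ℤ) :
    (side j * k + q i₀) / side j = k := by
  have := mem_cube.1 hq i₀
  rw [Int.mul_add_ediv_left _ _ (side_pos j).ne', Int.ediv_eq_zero_of_lt this.1 this.2, add_zero]

lemma white_cube (hb₀ : 2 * side j ∣ b i₀) (hb₁ : gap j ∣ b i₁) (hq : q ∈ cube d (side j))
    (hlow : ¬ ∃ i < j, InSlab i₁ i q) : b + q ∈ net i₀ i₁ := by
  push Not at hlow
  refine Or.inr ⟨j, (inSlab_add_iff hb₁ le_rfl).2 (inSlab_of_mem_cube hq),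
    fun i hi h => hlow i hi ((inSlab_add_iff hb₁ hi.le).1 h), ?_⟩
  obtain ⟨k, hk⟩ := hb₀
  rw [Pi.add_apply, hk, show 2 * side j * k = side j * (2 * k) by ring, ediv_side_of_mem_cube hq]
  exact even_two_mul k

lemma black_cube (h01 : i₀ ≠ i₁) (hb₀ : 2 * side j ∣ b i₀) (hb₁ : gap j ∣ b i₁)
    (hq : q ∈ cube d (side j)) (hnet : b + Pi.single i₀ (side j) + q ∈ net i₀ i₁) :
    q i₀ % 2 < 1 ∨ ∃ i < j, InSlab i₁ i q := by
  by_contra! hcon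
  obtain ⟨hodd, hlow⟩ := hcon
  obtain ⟨k, hk⟩ := hb₀
  have hb₁' : gap j ∣ (b + Pi.single i₀ (side j) : Fin d → ℤ) i₁ := by
    simpa [Pi.single_eq_of_ne h01.symm] using hb₁
  have hval : (b + Pi.single i₀ (side j) + q : Fin d → ℤ) i₀ = side j * (2 * k + 1) + q i₀ := by
    simp only [Pi.add_apply, Pi.single_eq_same, hk]; ring
  rcases hnet with hev | ⟨j', hin, hmin, hev⟩
  · rw [hval] at hev
    have := (Int.even_add.1 hev).1 ((even_side j).mul_right _)
    rw [Int.even_iff] at this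
    omega
  · have hj' : j' = j := by
      rcases lt_trichotomy j' j with h | h | h
      · exact absurd ((inSlab_add_iff hb₁' h.le).1 hin) (hlow j' h)
      · exact h
      · exact absurd ((inSlab_add_iff hb₁' le_rfl).2 (inSlab_of_mem_cube hq)) (hmin j h)
    subst hj'
    rw [hval, ediv_side_of_mem_cube hq] at hev
    exact Int.not_even_two_mul_add_one k hev

lemma evenFloor_mem_cube {c : ℤ} (hq : q ∈ cube d c) : evenFloor i₀ q ∈ cube d c := by
  rw [mem_cube] at hq ⊢
  intro t
  by_cases h : t = i₀
  · subst h
    have := hq t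
    simp only [evenFloor, Pi.sub_apply, Pi.single_eq_same]
    omega
  · simpa [evenFloor, h] using hq t

lemma even_evenFloor : Even (evenFloor i₀ q i₀) := by
  simp only [evenFloor, Pi.sub_apply, Pi.single_eq_same, Int.even_iff]
  omega

lemma abs_sub_evenFloor_le (t : Fin d) : |q t - evenFloor i₀ q t| ≤ 1 := by
  by_cases h : t = i₀
  · subst h
    simp only [evenFloor, Pi.sub_apply, Pi.single_eq_same, abs_le]
    omega
  · simp [evenFloor, h]

lemma dist_add_evenFloor_le : dist (lat (b + q)) (lat (b + evenFloor i₀ q)) ≤ 1 := by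
  have h : b + q = b + evenFloor i₀ q + Pi.single i₀ (q i₀ % 2) := by
    simp [evenFloor, add_assoc]
  rw [h, dist_lat_add_single]
  have : |q i₀ % 2| ≤ 1 := by rw [abs_le]; omega
  exact_mod_cast this

end Coloring

/-- `φ` is a bijection of the net onto the integer lattice which is `L`-bilipschitz near points
of the box `[-ρ, ρ]^d`. -/
structure Controlled {d : ℕ} (i₀ i₁ : Fin d) (φ : (Fin d → ℤ) → Euc d) (L : ℝ) (ρ : ℤ) :
    Prop where
  one_le : 1 ≤ L
  bij : BijOn φ (net i₀ i₁) (intLattice d)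
  lip : ∀ x ∈ net i₀ i₁, ∀ z ∈ net i₀ i₁, (∀ t, |x t| ≤ ρ) → (∀ t, |z t| ≤ ρ) →
    dist (φ x) (φ z) ≤ L * dist (lat x) (lat z)
  colip : ∀ x ∈ net i₀ i₁, ∀ z ∈ net i₀ i₁, (∀ t, |x t| ≤ ρ) → dist (φ x) (φ z) ≤ ρ →
    dist (lat x) (lat z) ≤ L * dist (φ x) (φ z)

section Stretch

variable {d : ℕ} {i₀ i₁ : Fin d} {φ : (Fin d → ℤ) → Euc d} {L : ℝ} {ρ : ℤ} {j : ℕ}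

open scoped Classical in
/-- A controlled bijection cannot act on most of a white cube and of the adjacent black cube
as translates of each other. -/
lemma lt_card_not_translated (h01 : i₀ ≠ i₁) (hφ : Controlled i₀ i₁ φ L ρ)
    (hj : 2 ^ 22 * (d : ℝ) ^ 3 * L ^ 6 ≤ 2 ^ j) (hρ : L + d + side j ≤ ρ) {b : Fin d → ℤ}
    (hb₀ : 2 * side j ∣ b i₀) (hb₁ : gap j ∣ b i₁)
    (hbox : ∀ q ∈ cube d (side j), (∀ t, |(b + q) t| ≤ ρ) ∧
      ∀ t, |(b + q + Pi.single i₀ (side j) : Fin d → ℤ) t| ≤ ρ) (V : Euc d) :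
    (side j : ℝ) ^ d / 16 < ((cube d (side j)).filter fun q =>
      side j / (64 * d * L) < ‖φ (b + evenFloor i₀ q + Pi.single i₀ (side j)) -
        φ (b + evenFloor i₀ q) - V‖).card := by
  have hL := hφ.one_le
  have hd : 0 < d := i₀.pos
  have hd1 : (1 : ℝ) ≤ d := by exact_mod_cast hd
  have hc : (0 : ℝ) < side j := by exact_mod_cast side_pos j
  have hcj : (2 : ℝ) ^ j ≤ side j := by exact_mod_cast two_pow_le_side j
  have hL6 : L ^ 2 ≤ L ^ 6 := pow_le_pow_right₀ hL (by norm_num)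
  have hd3 : (d : ℝ) ^ 2 ≤ d ^ 3 := pow_le_pow_right₀ hd1 (by norm_num)
  have hLL : L ≤ L ^ 2 := le_self_pow₀ hL (by norm_num)
  have hdd : (d : ℝ) ≤ d ^ 2 := le_self_pow₀ hd1 (by norm_num)
  have hsize : 64 * d * (L ^ 2 + d * L + 2) ≤ (side j : ℝ) := by
    have h1 : L ^ 2 + d * L + 2 ≤ 4 * d * L ^ 2 := by nlinarith
    have h2 : 64 * d * (L ^ 2 + d * L + 2) ≤ 256 * (d ^ 2 * L ^ 2) := by nlinarith
    have h3 : (d : ℝ) ^ 2 * L ^ 2 ≤ d ^ 3 * L ^ 6 := by gcongr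
    have h4 : 0 ≤ (d : ℝ) ^ 3 * L ^ 6 := by positivity
    linarith
  set C := cube d (side j) with hC
  set η : ℝ := side j / (64 * d * L) with hη
  set e : Fin d → ℤ := Pi.single i₀ (side j) with he
  by_contra! hbad
  obtain ⟨v, hv⟩ := exists_lat_near V
  have hη0 : 0 < η := by positivity
  have hηc : η ≤ side j := by
    refine div_le_self hc.le ?_
    nlinarith
  have hLη : L * η = side j / (64 * d) := by
    rw [hη]; field_simp
  set D : ℤ := ⌈L * (L + d + η)⌉ + 1 with hD
  have hDlow : L * (L + d + η) + 1 ≤ D := by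
    rw [hD]; push_cast; linarith [Int.le_ceil (L * (L + d + η))]
  have hDup : (D : ℝ) ≤ L * (L + d + η) + 2 := by
    rw [hD]; push_cast; linarith [Int.ceil_lt_add_one (L * (L + d + η))]
  have hD0 : 0 ≤ D := by
    have : (0 : ℝ) ≤ D := le_trans (by positivity) hDlow
    exact_mod_cast this
  have hDc : 32 * d * D ≤ side j := by
    have : (32 * d * D : ℝ) ≤ side j := by
      have h1 : (32 * d : ℝ) * (L * η) = side j / 2 := by rw [hLη]; field_simp; norm_num
      have h2 : (32 * d : ℝ) * D ≤ 32 * d * (L * (L + d + η) + 2) := by gcongr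
      nlinarith
    exact_mod_cast this
  set low := C.filter fun q => ∃ i < j, InSlab i₁ i q with hlow
  set bdry := C.filter fun q => ¬ ∀ t, D ≤ q t ∧ q t < side j - D with hbdry
  set bad := C.filter fun q => η < ‖φ (b + evenFloor i₀ q + e) - φ (b + evenFloor i₀ q) - V‖
    with hbaddef
  set ev := C.filter fun q => q i₀ % 2 < 1 with hev
  have hbe : Even (b i₀) := (even_two_mul _).trans_dvd hb₀
  have hevnet : ∀ q ∈ C, b + evenFloor i₀ q ∈ net i₀ i₁ := fun q _ =>
    Or.inl (hbe.add even_evenFloor)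
  have hevnet' : ∀ q ∈ C, b + evenFloor i₀ q + e ∈ net i₀ i₁ := fun q _ =>
    Or.inl ((hbe.add even_evenFloor).add (by simpa [he] using even_side j))
  have key : ∀ q ∈ C \ (low ∪ bdry ∪ bad), ∃ w ∈ net i₀ i₁, φ w = φ (b + q) + lat v ∧
      w - b - e ∈ ev ∪ low := by
    intro q hq
    simp only [Finset.mem_sdiff, Finset.mem_union, hlow, hbdry, hbaddef, Finset.mem_filter,
      not_or, not_and, not_not, not_lt] at hq
    obtain ⟨hqC, ⟨hq1, hq2⟩, hq3⟩ := hq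
    replace hq1 := hq1 hqC
    replace hq2 := hq2 hqC
    replace hq3 := hq3 hqC
    have hqnet : b + q ∈ net i₀ i₁ := white_cube hb₀ hb₁ hqC hq1
    obtain ⟨m, hm⟩ := exists_lat_eq (hφ.bij.mapsTo hqnet)
    obtain ⟨w, hw, hwφ⟩ := hφ.bij.surjOn (lat_mem_intLattice (m + v))
    have hmv : lat (m + v) = φ (b + q) + lat v := by
      rw [← hm]; ext t; simp [lat]
    rw [hmv] at hwφ
    have hqe := evenFloor_mem_cube (i₀ := i₀) hqC
    have hd1 : dist (φ (b + q)) (φ (b + evenFloor i₀ q)) ≤ L := by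
      refine (hφ.lip _ hqnet _ (hevnet q hqC) (hbox q hqC).1 (hbox _ hqe).1).trans ?_
      exact mul_le_of_le_one_right (by linarith) dist_add_evenFloor_le
    have hd2 : dist (φ (b + evenFloor i₀ q + e)) (φ w) ≤ L + d + η := by
      rw [dist_comm, dist_eq_norm, hwφ]
      have : φ (b + q) + lat v - φ (b + evenFloor i₀ q + e) =
          (φ (b + q) - φ (b + evenFloor i₀ q)) + (lat v - V) -
          (φ (b + evenFloor i₀ q + e) - φ (b + evenFloor i₀ q) - V) := by abel
      rw [this]
      rw [dist_eq_norm] at hd1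
      exact (norm_sub_le _ _).trans (add_le_add ((norm_add_le _ _).trans (add_le_add hd1 hv)) hq3)
    have hd3 := hφ.colip _ (hevnet' q hqC) w hw (hbox _ hqe).2 (by linarith)
    have hcoord : ∀ t, |(b + evenFloor i₀ q + e) t - w t| ≤ D - 1 := by
      intro t
      have h1 := abs_sub_le_dist_lat (b + evenFloor i₀ q + e) w t
      have h2 : L * dist (φ (b + evenFloor i₀ q + e)) (φ w) ≤ L * (L + d + η) := by gcongr
      have : ((|(b + evenFloor i₀ q + e) t - w t| : ℤ) : ℝ) ≤ ((D - 1 : ℤ) : ℝ) := by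
        push_cast at h1 ⊢
        linarith
      exact_mod_cast this
    have hwC : w - b - e ∈ C := by
      rw [hC, mem_cube]
      intro t
      have h1 := abs_le.1 (hcoord t)
      have h2 := abs_le.1 (abs_sub_evenFloor_le (i₀ := i₀) (q := q) t)
      have h3 := hq2 t
      simp only [Pi.add_apply, Pi.sub_apply] at h1 ⊢
      constructor <;> linarith [h1.1, h1.2, h2.1, h2.2, h3.1, h3.2]
    refine ⟨w, hw, hwφ, ?_⟩
    have hwnet : b + e + (w - b - e) ∈ net i₀ i₁ := by
      convert hw using 1; abel
    rcases black_cube h01 hb₀ hb₁ hwC hwnet with h | h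
    · exact Finset.mem_union_left _ (Finset.mem_filter.2 ⟨hwC, h⟩)
    · exact Finset.mem_union_right _ (Finset.mem_filter.2 ⟨hwC, h⟩)
  choose! w hw hwφ hwm using key
  have hinj : (C \ (low ∪ bdry ∪ bad)).card ≤ (ev ∪ low).card := by
    refine Finset.card_le_card_of_injOn (fun q => w q - b - e) hwm ?_
    have hnet : ∀ q ∈ C \ (low ∪ bdry ∪ bad), b + q ∈ net i₀ i₁ := by
      intro q hq
      simp only [Finset.mem_sdiff, Finset.mem_union, not_or, hlow, Finset.mem_filter,
        not_and] at hq
      exact white_cube hb₀ hb₁ hq.1 (hq.2.1.1 hq.1)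
    intro q hq q' hq' h
    have hww : w q = w q' := by simpa using h
    have : φ (b + q) = φ (b + q') := by
      have := hwφ q hq
      rw [hww, hwφ q' hq'] at this
      exact (add_right_cancel this).symm
    exact add_left_cancel (hφ.bij.injOn (hnet q hq) (hnet q' hq') this)
  have hcover : C.card ≤ (C \ (low ∪ bdry ∪ bad)).card + (low.card + bdry.card + bad.card) := by
    have h1 : C ⊆ (C \ (low ∪ bdry ∪ bad)) ∪ (low ∪ bdry ∪ bad) := by
      intro q hq; simp only [Finset.mem_union, Finset.mem_sdiff]; tauto
    have h2 := Finset.card_le_card h1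
    have h3 := Finset.card_union_le (C \ (low ∪ bdry ∪ bad)) (low ∪ bdry ∪ bad)
    have h4 := Finset.card_union_le (low ∪ bdry) bad
    have h5 := Finset.card_union_le low bdry
    omega
  have htot : C.card ≤ (ev.card + low.card) + (low.card + bdry.card + bad.card) := by
    have := Finset.card_union_le ev low
    omega
  have htot' : (C.card : ℝ) ≤ (ev.card + low.card) + (low.card + bdry.card + bad.card) := by
    exact_mod_cast htot
  have e1 : (C.card : ℝ) = (side j : ℝ) ^ d := card_cube (side_pos j).le
  have e2 : (low.card : ℝ) ≤ (side j : ℝ) ^ d / 32 := card_lower_slabs_le i₁ j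
  have e3 : (bdry.card : ℝ) ≤ (side j : ℝ) ^ d / 16 :=
    card_cube_boundary_le (side_pos j) hD0 hDc hd
  have e4 : (ev.card : ℝ) ≤ (1 : ℤ) / (2 : ℤ) * (side j : ℝ) ^ d :=
    card_cube_filter_le (side_pos j) two_pos (even_side j).two_dvd zero_le_one i₀
  have e5 : 0 < (side j : ℝ) ^ d := by positivity
  push_cast at e4
  linarith


lemma exists_small_defect {ι : Type*} (Q : Finset ι) (a : ι → ℕ → ℝ) {N : ℕ} (hN : 0 < N)
    {T B : ℝ} (hT : ∀ q ∈ Q, ∀ i < 2 * N, a q i ≤ T)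
    (hsum : ∀ q ∈ Q, 2 * N * T - B ≤ ∑ i ∈ Finset.range (2 * N), a q i) :
    ∃ m < N, ∑ q ∈ Q, (T - a q (2 * m)) ≤ Q.card * B / N := by
  have hhalf : ∀ q ∈ Q, ∑ m ∈ Finset.range N, (T - a q (2 * m)) ≤ B := by
    intro q hq
    have h1 : ∀ n ≤ N, ∑ m ∈ Finset.range n, (T - a q (2 * m)) ≤
        ∑ i ∈ Finset.range (2 * n), (T - a q i) := by
      intro n hn
      induction n with
      | zero => simp
      | succ n ih =>
        have h2 := hT q hq (2 * n + 1) (by omega)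
        rw [Finset.sum_range_succ, show 2 * (n + 1) = 2 * n + 1 + 1 by ring,
          Finset.sum_range_succ, Finset.sum_range_succ]
        linarith [ih (by omega)]
    refine (h1 N le_rfl).trans ?_
    have := hsum q hq
    rw [Finset.sum_sub_distrib]
    simp only [Finset.sum_const, Finset.card_range, nsmul_eq_mul, Nat.cast_mul, Nat.cast_ofNat]
    linarith
  have hN' : (0 : ℝ) < N := by exact_mod_cast hN
  obtain ⟨m, hm, h⟩ := Finset.exists_le_of_sum_le (s := Finset.range N)
    (f := fun m => ∑ q ∈ Q, (T - a q (2 * m))) (g := fun _ => Q.card * B / N) ⟨0, by simpa⟩ (by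
      rw [Finset.sum_comm]
      refine (Finset.sum_le_sum hhalf).trans (le_of_eq ?_)
      simp only [Finset.sum_const, Finset.card_range, nsmul_eq_mul]
      field_simp)
  exact ⟨m, Finset.mem_range.1 hm, h⟩

lemma norm_sub_smul_sq_le {u w : Euc d} {T τ : ℝ} (hu : ‖u‖ = 1) (hw : ‖w‖ ≤ T)
    (h : T - inner ℝ u w ≤ τ) : ‖w - T • u‖ ^ 2 ≤ 2 * T * τ := by
  have hT : 0 ≤ T := (norm_nonneg _).trans hw
  rw [norm_sub_sq_real, norm_smul, hu, inner_smul_right, real_inner_comm, Real.norm_eq_abs, mul_one,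
    sq_abs]
  nlinarith [pow_le_pow_left₀ (norm_nonneg w) hw 2]

/-- A stretched horizontal pair at one scale forces a nearby, more stretched one at the next
smaller scale. -/
lemma exists_more_stretched (h01 : i₀ ≠ i₁) (hφ : Controlled i₀ i₁ φ L ρ)
    (hj : 2 ^ 22 * (d : ℝ) ^ 3 * L ^ 6 ≤ 2 ^ j) (hρ : L + d + side j ≤ ρ) {x : Fin d → ℤ}
    (hx : Even (x i₀)) (hbox : ∀ t, |x t| ≤ ρ - 2 * side (j + 1)) {A : ℝ} (hA : 1 / L ≤ A)
    (hstretch : A * side (j + 1) ≤ dist (φ (x + Pi.single i₀ (side (j + 1)))) (φ x)) :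
    ∃ y : Fin d → ℤ, Even (y i₀) ∧ (∀ t, |y t - x t| ≤ 2 * side (j + 1)) ∧
      (1 + 1 / (2 ^ 20 * d ^ 2 * L ^ 4)) * A * side j ≤
        dist (φ (y + Pi.single i₀ (side j))) (φ y) := by
  classical
  by_contra! hcon
  have hL := hφ.one_le
  have hL0 : 0 < L := by linarith
  have hA0 : 0 < A := lt_of_lt_of_le (by positivity) hA
  have hd : 0 < d := i₀.pos
  have hd1 : (1 : ℝ) ≤ d := by exact_mod_cast hd
  have hc0 := side_pos j
  have hg0 := gap_pos j
  have hcg := side_le_gap j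
  have hgℓ := gap_le_side_succ j
  set c := side j with hc
  set g := gap j with hg
  set ℓ := side (j + 1) with hℓ
  have hcr : (0 : ℝ) < c := by exact_mod_cast hc0
  have hgr : (0 : ℝ) < g := by exact_mod_cast hg0
  have hℓr : (0 : ℝ) < ℓ := by exact_mod_cast side_pos (j + 1)
  set k : ℝ := 1 / (2 ^ 20 * d ^ 2 * L ^ 4) with hk
  have hk0 : 0 < k := by positivity
  have hk1 : k ≤ 1 := by
    rw [hk, div_le_one (by positivity)]
    have h1 := one_le_pow₀ hL (n := 4)
    have h2 := one_le_pow₀ hd1 (n := 2)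
    nlinarith [mul_le_mul h2 h1 (by norm_num) (by positivity)]
  set N : ℕ := 2 ^ (2 * j + 5) with hN
  have hN0 : 0 < N := by positivity
  have hNr : (0 : ℝ) < N := by exact_mod_cast hN0
  have hℓc : ℓ = c * (2 * N) := by
    rw [hℓ, side_succ, gap_eq, hN]
    push_cast
    ring
  have hℓcr : (ℓ : ℝ) = c * (2 * N) := by exact_mod_cast hℓc
  set z : Fin d → ℤ := x - Pi.single i₀ (x i₀ % (2 * c)) - Pi.single i₁ (x i₁ % g) with hz
  have hz₀ : z i₀ = x i₀ - x i₀ % (2 * c) := by simp [hz, Pi.single_eq_of_ne h01]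
  have hz₁ : z i₁ = x i₁ - x i₁ % g := by simp [hz, Pi.single_eq_of_ne h01.symm]
  have hzt : ∀ t, t ≠ i₀ → t ≠ i₁ → z t = x t := fun t h h' => by simp [hz, h, h']
  have hzd₀ : 2 * c ∣ z i₀ := by rw [hz₀]; exact Int.dvd_self_sub_emod
  have hzd₁ : g ∣ z i₁ := by rw [hz₁]; exact Int.dvd_self_sub_emod
  have hnear : ∀ q ∈ cube d c, ∀ t, |(z + q) t - x t| ≤ 2 * g ∧ (z + q) t - x t ≤ c := by
    intro q hq t
    have hqt := mem_cube.1 hq t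
    rw [Pi.add_apply, abs_le]
    by_cases h : t = i₀
    · subst h
      have h1 := Int.emod_nonneg (x t) (by omega : 2 * c ≠ 0)
      have h2 := Int.emod_lt_of_pos (x t) (by omega : 0 < 2 * c)
      rw [hz₀]; omega
    · by_cases h' : t = i₁
      · subst h'
        have h1 := Int.emod_nonneg (x t) hg0.ne'
        have h2 := Int.emod_lt_of_pos (x t) hg0
        rw [hz₁]; omega
      · rw [hzt t h h']; omega
  set P : (Fin d → ℤ) → ℕ → (Fin d → ℤ) := fun q i => z + q + Pi.single i₀ (c * i) with hP
  have hPsucc : ∀ q i, P q (i + 1) = P q i + Pi.single i₀ c := by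
    intro q i
    simp only [hP]
    rw [add_assoc (z + q), ← Pi.single_add]
    congr 2
    push_cast
    ring
  have hPnear : ∀ q ∈ cube d c, ∀ i ≤ 2 * N, ∀ t, |P q i t - x t| ≤ 2 * ℓ := by
    intro q hq i hi t
    have h1 := hnear q hq t
    have h2 : c * i ≤ ℓ := by
      rw [hℓc]
      have : (i : ℤ) ≤ 2 * N := by exact_mod_cast hi
      gcongr
    have h3 : 0 ≤ c * i := by positivity
    rw [abs_le] at h1 ⊢
    simp only [hP]
    rw [Pi.add_apply]
    by_cases h : t = i₀
    · subst h
      rw [Pi.single_eq_same]; omega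
    · rw [Pi.single_eq_of_ne h]; omega
  have hPbox : ∀ q ∈ cube d c, ∀ i ≤ 2 * N, ∀ t, |P q i t| ≤ ρ := by
    intro q hq i hi t
    have h1 := hPnear q hq i hi t
    have h2 := hbox t
    rw [abs_le] at *
    omega
  have hPeven : ∀ q i, Even (P (evenFloor i₀ q) i i₀) := by
    intro q i
    have h1 : Even (z i₀) := (even_two_mul _).trans_dvd hzd₀
    simp only [hP, Pi.add_apply, Pi.single_eq_same]
    exact (h1.add even_evenFloor).add ((even_side j).mul_right _)
  set T : ℝ := (1 + k) * A * c with hT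
  have hTle : ∀ q ∈ cube d c, ∀ i < 2 * N,
      ‖φ (P (evenFloor i₀ q) (i + 1)) - φ (P (evenFloor i₀ q) i)‖ ≤ T := by
    intro q hq i hi
    rw [← dist_eq_norm, hPsucc]
    exact (hcon _ (hPeven q i) (hPnear _ (evenFloor_mem_cube hq) i hi.le)).le
  set e : Fin d → ℤ := Pi.single i₀ ℓ with he
  set w : Euc d := φ (x + e) - φ x with hw
  have hxnet : x ∈ net i₀ i₁ := Or.inl hx
  have hxenet : x + e ∈ net i₀ i₁ := Or.inl (by
    simpa [he] using hx.add (even_side (j + 1)))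
  have hxbox : ∀ t, |x t| ≤ ρ := fun t => by
    have := hbox t
    omega
  have hxebox : ∀ t, |(x + e) t| ≤ ρ := by
    intro t
    have h2 := hbox t
    rw [abs_le] at *
    rw [Pi.add_apply]
    by_cases h : t = i₀
    · subst h
      rw [he, Pi.single_eq_same]; omega
    · rw [he, Pi.single_eq_of_ne h]; omega
  have hwA : A * ℓ ≤ ‖w‖ := hstretch.trans_eq (dist_eq_norm (φ (x + e)) (φ x))
  have hw0 : 0 < ‖w‖ := (mul_pos hA0 hℓr).trans_le hwA
  have hAL : A ≤ L := by
    have h1 := hφ.lip _ hxenet _ hxnet hxebox hxbox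
    rw [dist_lat_add_single, abs_of_pos hℓr] at h1
    exact le_of_mul_le_mul_right (hstretch.trans h1) hℓr
  set u : Euc d := ‖w‖⁻¹ • w with hu
  have hu1 : ‖u‖ = 1 := by
    rw [hu, norm_smul, norm_inv, norm_norm, inv_mul_cancel₀ hw0.ne']
  have huw : A * ℓ ≤ inner ℝ u w := by
    rw [hu, real_inner_smul_left, real_inner_self_eq_norm_sq]
    refine hwA.trans (le_of_eq ?_)
    field_simp
  have hmove : ∀ q ∈ cube d c,
      A * ℓ * (1 - k) ≤ inner ℝ u (φ (P (evenFloor i₀ q) (2 * N)) - φ (P (evenFloor i₀ q) 0)) := by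
    intro q hq
    have hq' := evenFloor_mem_cube (i₀ := i₀) hq
    have hP0 : P (evenFloor i₀ q) 0 = z + evenFloor i₀ q := by simp [hP]
    have hPN : P (evenFloor i₀ q) (2 * N) = z + evenFloor i₀ q + e := by
      simp only [hP, he]
      push_cast
      rw [← hℓc]
    have h1 : dist (φ (P (evenFloor i₀ q) 0)) (φ x) ≤ L * (d * (2 * g : ℤ)) := by
      refine (hφ.lip _ (Or.inl (hPeven q 0)) _ hxnet (hPbox _ hq' 0 (by omega)) hxbox).trans ?_
      gcongr
      exact dist_lat_le fun t => hP0 ▸ (hnear _ hq' t).1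
    have h2 : dist (φ (P (evenFloor i₀ q) (2 * N))) (φ (x + e)) ≤ L * (d * (2 * g : ℤ)) := by
      refine (hφ.lip _ (Or.inl (hPeven q _)) _ hxenet (hPbox _ hq' _ le_rfl) hxebox).trans ?_
      gcongr
      refine dist_lat_le fun t => ?_
      rw [hPN, Pi.add_apply, Pi.add_apply x, add_sub_add_right_eq_sub]
      exact (hnear _ hq' t).1
    have hsplit : φ (P (evenFloor i₀ q) (2 * N)) - φ (P (evenFloor i₀ q) 0) =
        w + ((φ (P (evenFloor i₀ q) (2 * N)) - φ (x + e)) - (φ (P (evenFloor i₀ q) 0) - φ x)) := by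
      rw [hw]; abel
    have h3 := abs_le.1 (abs_real_inner_le_norm u
      ((φ (P (evenFloor i₀ q) (2 * N)) - φ (x + e)) - (φ (P (evenFloor i₀ q) 0) - φ x)))
    rw [hu1, one_mul] at h3
    have h4 := norm_sub_le (φ (P (evenFloor i₀ q) (2 * N)) - φ (x + e))
      (φ (P (evenFloor i₀ q) 0) - φ x)
    rw [dist_eq_norm] at h1 h2
    rw [hsplit, inner_add_right]
    have h5 : 4 * d * L * g ≤ k * (A * ℓ) := by
      have hℓg : (ℓ : ℝ) = g * 2 ^ j := by
        rw [hℓ, side_succ]; push_cast; rfl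
      have h6 : 4 * d * L ^ 2 ≤ k * 2 ^ j := by
        rw [hk, div_mul_eq_mul_div, one_mul, le_div_iff₀ (by positivity)]
        refine le_trans (le_of_eq ?_) hj
        ring
      have h7 : 4 * d * L ≤ k * 2 ^ j * A := by
        have : 4 * d * L = 4 * d * L ^ 2 * (1 / L) := by field_simp
        rw [this]
        gcongr
      calc 4 * d * L * g ≤ k * 2 ^ j * A * g := by gcongr
        _ = k * (A * ℓ) := by rw [hℓg]; ring
    push_cast at h1 h2
    linarith [h3.1]
  obtain ⟨m, hmN, hm⟩ := exists_small_defect (cube d c)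
    (fun q i => inner ℝ u (φ (P (evenFloor i₀ q) (i + 1)) - φ (P (evenFloor i₀ q) i)))
    hN0 (T := T) (B := 4 * k * A * c * N) (by
      intro q hq i hi
      refine (real_inner_le_norm _ _).trans ?_
      rw [hu1, one_mul]
      exact hTle q hq i hi) (by
      intro q hq
      rw [← inner_sum, Finset.sum_range_sub fun i => φ (P (evenFloor i₀ q) i)]
      refine le_trans (le_of_eq ?_) (hmove q hq)
      rw [hT, hℓcr]
      ring)
  have hbe : ∀ q : Fin d → ℤ, z + Pi.single i₀ (c * (2 * m : ℕ)) + q = P q (2 * m) := by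
    intro q; simp only [hP]; abel
  have hbad := lt_card_not_translated h01 hφ hj hρ (b := z + Pi.single i₀ (c * (2 * m : ℕ)))
    (by
      rw [Pi.add_apply, Pi.single_eq_same]
      refine dvd_add hzd₀ ⟨m, ?_⟩
      push_cast; ring)
    (by
      rw [Pi.add_apply, Pi.single_eq_of_ne h01.symm, add_zero]
      exact hzd₁)
    (by
      intro q hq
      rw [hbe, ← hc, ← hPsucc]
      exact ⟨hPbox q hq _ (by omega), hPbox q hq _ (by omega)⟩) (T • u)
  simp only [hbe, ← hc, ← hPsucc] at hbad
  set bad := (cube d c).filter fun q => (c : ℝ) / (64 * d * L) <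
    ‖φ (P (evenFloor i₀ q) (2 * m + 1)) - φ (P (evenFloor i₀ q) (2 * m)) - T • u‖ with hbd
  have hmarkov : bad.card * (64 * k * A * c) ≤ ∑ q ∈ cube d c,
      (T - inner ℝ u (φ (P (evenFloor i₀ q) (2 * m + 1)) - φ (P (evenFloor i₀ q) (2 * m)))) := by
    have h0 : ∀ q ∈ cube d c, 0 ≤
        T - inner ℝ u (φ (P (evenFloor i₀ q) (2 * m + 1)) - φ (P (evenFloor i₀ q) (2 * m))) := by
      intro q hq
      have h1 := real_inner_le_norm u
        (φ (P (evenFloor i₀ q) (2 * m + 1)) - φ (P (evenFloor i₀ q) (2 * m)))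
      rw [hu1, one_mul] at h1
      linarith [hTle q hq (2 * m) (by omega)]
    refine le_trans ?_ (Finset.sum_le_sum_of_subset_of_nonneg
      (Finset.filter_subset _ _ : bad ⊆ cube d c) fun q hq _ => h0 q hq)
    rw [← nsmul_eq_mul]
    refine Finset.card_nsmul_le_sum _ _ _ fun q hq => ?_
    rw [hbd, Finset.mem_filter] at hq
    by_contra! hlt
    have h1 := norm_sub_smul_sq_le hu1 (hTle q hq.1 (2 * m) (by omega)) hlt.le
    have h2 : 2 * T * (64 * k * A * c) ≤ (c / (64 * d * L)) ^ 2 := by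
      have h3 : 2 * T ≤ 4 * L * c := by
        rw [hT]
        have : (1 + k) * A ≤ 2 * L := by nlinarith
        nlinarith
      have h4 : 64 * k * A * c ≤ 64 * k * L * c := by gcongr
      calc 2 * T * (64 * k * A * c) ≤ 4 * L * c * (64 * k * L * c) := by gcongr
        _ = (c / (64 * d * L)) ^ 2 := by
          rw [hk]; field_simp; norm_num
    exact absurd (le_of_sq_le_sq (h1.trans h2) (by positivity)) hq.2.not_ge
  have hfin := hmarkov.trans hm
  rw [card_cube hc0.le] at hfin
  have h1 : (bad.card : ℝ) * 16 ≤ (c : ℝ) ^ d := by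
    have h2 : (c : ℝ) ^ d * (4 * k * A * c * N) / N = (c : ℝ) ^ d * (4 * k * A * c) := by
      field_simp
    rw [h2] at hfin
    have h3 : 0 < 4 * k * A * c := by positivity
    refine le_of_mul_le_mul_right ?_ h3
    linarith
  linarith


lemma not_controlled (h01 : i₀ ≠ i₁) {n : ℕ} (hn : 2 ^ 22 * (d : ℝ) ^ 3 * L ^ 6 < n)
    (hφ : Controlled i₀ i₁ φ L (4 * side (2 * n))) : False := by
  have hL := hφ.one_le
  have hL0 : 0 < L := by linarith
  have hd : 0 < d := i₀.pos
  have hd1 : (1 : ℝ) ≤ d := by exact_mod_cast hd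
  have hnpow : ∀ j, n ≤ j → (n : ℝ) ≤ 2 ^ j := fun j h => by
    exact_mod_cast (Nat.lt_two_pow_self.le).trans (Nat.pow_le_pow_right two_pos h)
  have hLd : L + d ≤ n := by
    have h1 : (d : ℝ) ≤ d ^ 3 := le_self_pow₀ hd1 (by norm_num)
    have h2 : L ≤ L ^ 6 := le_self_pow₀ hL (by norm_num)
    have h3 : (d : ℝ) * L ≤ d ^ 3 * L ^ 6 := by gcongr
    nlinarith
  have hmono : Monotone side := monotone_nat_of_le_succ fun j => by
    linarith [two_side_le_side_succ j, side_pos j]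
  set k : ℝ := 1 / (2 ^ 20 * d ^ 2 * L ^ 4) with hk
  have hk0 : 0 < k := by positivity
  have hiter : ∀ m ≤ n, ∀ j, m + j = 2 * n → ∃ x : Fin d → ℤ, Even (x i₀) ∧
      (∀ t, |x t| ≤ 4 * side (2 * n) - 4 * side j) ∧
      (1 + k) ^ m * (1 / L) * side j ≤ dist (φ (x + Pi.single i₀ (side j))) (φ x) := by
    intro m
    induction m with
    | zero =>
      rintro - j hj
      obtain rfl : j = 2 * n := by omega
      refine ⟨0, by simp, by simp, ?_⟩
      have hs := side_pos (2 * n)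
      have hsr : (0 : ℝ) < side (2 * n) := by exact_mod_cast hs
      rw [pow_zero, one_mul, div_mul_eq_mul_div, one_mul, div_le_iff₀' hL0, dist_comm]
      by_cases h : dist (φ 0) (φ (0 + Pi.single i₀ (side (2 * n)))) ≤ ((4 * side (2 * n) : ℤ) : ℝ)
      · have h0 : (0 : Fin d → ℤ) ∈ net i₀ i₁ := Or.inl (by simp)
        have h1 : 0 + Pi.single i₀ (side (2 * n)) ∈ net i₀ i₁ := Or.inl (by
          simpa using even_side (2 * n))
        have h2 : ∀ t, |(0 : Fin d → ℤ) t| ≤ 4 * side (2 * n) := fun t => by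
          rw [Pi.zero_apply, abs_zero]; linarith
        have := hφ.colip 0 h0 _ h1 h2 h
        rwa [dist_comm, dist_lat_add_single, abs_of_pos hsr] at this
      · push Not at h
        push_cast at h
        nlinarith
    | succ m ih =>
      intro hm j hj
      obtain ⟨x, hx, hxb, hxs⟩ := ih (by omega) (j + 1) (by omega)
      have hnj := hnpow j (by omega)
      have hsj : side j ≤ side (2 * n) := hmono (by omega)
      have hjs : ((2 : ℝ)) ^ j ≤ side j := by exact_mod_cast two_pow_le_side j
      have hA : 1 / L ≤ (1 + k) ^ m * (1 / L) :=
        le_mul_of_one_le_left (by positivity) (one_le_pow₀ (by linarith))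
      obtain ⟨y, hy, hyx, hys⟩ := exists_more_stretched h01 hφ (hn.le.trans hnj) (by
          have : (side j : ℝ) ≤ side (2 * n) := by exact_mod_cast hsj
          push_cast
          linarith) hx
        (fun t => by linarith [hxb t, side_pos (j + 1)]) hA hxs
      refine ⟨y, hy, fun t => ?_, ?_⟩
      · have h1 := hyx t
        have h2 := hxb t
        have h3 := two_side_le_side_succ j
        rw [abs_le] at *
        omega
      · rw [pow_succ, mul_comm _ (1 + k), mul_assoc (1 + k)]
        exact hys
  obtain ⟨x, hx, hxb, hxs⟩ := hiter n le_rfl n (by omega)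
  have hs := side_pos n
  have hsr : (0 : ℝ) < side n := by exact_mod_cast hs
  have hlip := hφ.lip (x + Pi.single i₀ (side n)) (Or.inl (by simpa using hx.add (even_side n)))
    x (Or.inl hx) (by
      intro t
      have := hxb t
      rw [abs_le] at *
      rw [Pi.add_apply]
      by_cases h : t = i₀
      · subst h
        rw [Pi.single_eq_same]; omega
      · rw [Pi.single_eq_of_ne h]; omega) (fun t => by linarith [hxb t])
  rw [dist_lat_add_single, abs_of_pos hsr] at hlip
  have h1 := le_of_mul_le_mul_right (hxs.trans hlip) hsr
  rw [mul_one_div, div_le_iff₀ hL0] at h1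
  have h2 := one_add_mul_le_pow (a := k) (by linarith) n
  have h3 : 4 * d * L ^ 2 ≤ n * k := by
    rw [hk, mul_one_div, le_div_iff₀ (by positivity)]
    refine le_trans (le_of_eq ?_) hn.le
    ring
  nlinarith

end Stretch

section Net

variable {d : ℕ}

lemma isSeparatedNet_net (i₀ i₁ : Fin d) : IsSeparatedNet (lat '' net i₀ i₁) := by
  refine ⟨1, d + 1, one_pos, by positivity, ?_, fun z => ?_⟩
  · rintro _ ⟨x, -, rfl⟩ _ ⟨y, -, rfl⟩ h
    exact one_le_dist_lat fun hxy => h (by rw [hxy])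
  · obtain ⟨x, hx⟩ := exists_lat_near z
    refine ⟨_, ⟨evenFloor i₀ x, Or.inl even_evenFloor, rfl⟩, ?_⟩
    have h := dist_add_evenFloor_le (i₀ := i₀) (b := 0) (q := x)
    rw [zero_add, zero_add] at h
    refine (dist_triangle z (lat x) _).trans (add_le_add ?_ h)
    rwa [dist_comm, dist_eq_norm]

lemma le_side (n : ℕ) : (n : ℝ) ≤ side (2 * n) := by
  have h : ((2 : ℝ)) ^ (2 * n) ≤ side (2 * n) := by exact_mod_cast two_pow_le_side (2 * n)
  refine le_trans ?_ h
  exact_mod_cast (Nat.lt_two_pow_self.le).trans (Nat.pow_le_pow_right two_pos (by omega : n ≤ 2 * n))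

lemma log_side_le {n : ℕ} (hn : 1 ≤ n) : Real.log (4 * side (2 * n)) ≤ 17 * (n : ℝ) ^ 2 := by
  have h : (4 * side (2 * n) : ℝ) = 2 ^ (4 * n ^ 2 + 10 * n + 3) := by
    rw [side]; push_cast
    rw [show (4 : ℝ) = 2 ^ 2 by norm_num, ← pow_add]
    congr 1
    ring
  have hlog : Real.log 2 ≤ 1 := by linarith [Real.log_two_lt_d9]
  have hn' : (1 : ℝ) ≤ n := by exact_mod_cast hn
  rw [h, Real.log_pow]
  push_cast
  nlinarith [Real.log_pos one_lt_two]

/-- A bijection of the net onto the lattice with slowly growing bilipschitz constants is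
controlled, with small constant, on arbitrarily large boxes. -/
lemma exists_controlled {i₀ i₁ : Fin d} {f : Euc d → Euc d}
    (hf : BijOn f (lat '' net i₀ i₁) (intLattice d)) {M R₀ : ℝ}
    (h : ∀ R, R₀ ≤ R → ∀ x ∈ lat '' net i₀ i₁ ∩ ball 0 R, ∀ y ∈ lat '' net i₀ i₁ ∩ ball 0 R,
      dist (f x) (f y) ≤ (M * (Real.log R) ^ (1 / 24 : ℝ)) * dist x y ∧
      dist x y ≤ (M * (Real.log R) ^ (1 / 24 : ℝ)) * dist (f x) (f y)) :
    ∃ (φ : (Fin d → ℤ) → Euc d) (L : ℝ) (n : ℕ), 2 ^ 22 * (d : ℝ) ^ 3 * L ^ 6 < n ∧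
      Controlled i₀ i₁ φ L (4 * side (2 * n)) := by
  set M' : ℝ := max M 1 with hM'
  have hM1 : 1 ≤ M' := le_max_right _ _
  have hMM : M ≤ M' := le_max_left _ _
  set B : ℝ := 2 ^ 22 * d ^ 3 * M' ^ 6 with hB
  have hB0 : 0 ≤ B := by positivity
  obtain ⟨n, hn⟩ := exists_nat_gt (max R₀ (max (1 + d + M' + 3) (68 * B ^ 4)))
  simp only [max_lt_iff] at hn
  obtain ⟨hnR, hnM, hnB⟩ := hn
  have hd0 : (0 : ℝ) ≤ d := d.cast_nonneg
  have hn3 : (3 : ℝ) < n := by linarith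
  set ρ : ℝ := 4 * side (2 * n) with hρ
  have hρn : (n : ℝ) ≤ ρ := by linarith [le_side n]
  set R : ℝ := ρ ^ 4 with hR
  have hρR : ρ ≤ R := le_self_pow₀ (by linarith) (by norm_num)
  have hdR : d * ρ < R := by
    have h1 : (1 : ℝ) ≤ ρ ^ 2 := one_le_pow₀ (by linarith)
    have h2 : d * ρ < ρ * ρ := mul_lt_mul_of_pos_right (by linarith) (by linarith)
    nlinarith
  set L : ℝ := M' * Real.log R ^ (1 / 24 : ℝ) with hL
  have hlogR : 1 ≤ Real.log R := by
    rw [Real.le_log_iff_exp_le (by linarith)]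
    linarith [Real.exp_one_lt_d9]
  have hpow1 : ∀ S, R ≤ S → 1 ≤ Real.log S ^ (1 / 24 : ℝ) := fun S hS =>
    Real.one_le_rpow (hlogR.trans (Real.log_le_log (by linarith) hS)) (by norm_num)
  have hL1 : 1 ≤ L := one_le_mul_of_one_le_of_one_le hM1 (hpow1 R le_rfl)
  have hML : M * Real.log R ^ (1 / 24 : ℝ) ≤ L :=
    mul_le_mul_of_nonneg_right hMM (by linarith [hpow1 R le_rfl])
  have hball : ∀ x : Fin d → ℤ, (∀ t, |x t| ≤ 4 * side (2 * n)) → ‖lat x‖ ≤ d * ρ := by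
    intro x hx
    have := norm_lat_le hx
    push_cast at this
    exact this
  refine ⟨f ∘ lat, L, n, ?_, hL1, ?_, ?_, ?_⟩
  · set y : ℝ := Real.log R ^ (1 / 4 : ℝ) with hy
    have hy0 : 0 ≤ y := Real.rpow_nonneg (by linarith) _
    have hL6 : L ^ 6 = M' ^ 6 * y := by
      rw [hL, mul_pow, ← Real.rpow_mul_natCast (by linarith)]
      norm_num [hy]
    have hy4 : y ^ 4 ≤ 68 * (n : ℝ) ^ 2 := by
      rw [hy, ← Real.rpow_mul_natCast (by linarith)]
      norm_num
      rw [hR, Real.log_pow]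
      have := log_side_le (n := n) (by exact_mod_cast (by linarith : (1 : ℝ) ≤ n))
      push_cast
      linarith
    have hBy : 2 ^ 22 * (d : ℝ) ^ 3 * L ^ 6 = B * y := by rw [hL6, hB]; ring
    rw [hBy]
    by_contra! hle
    have h1 : (n : ℝ) ^ 4 ≤ (B * y) ^ 4 := by gcongr
    have h2 : (B * y) ^ 4 ≤ B ^ 4 * (68 * (n : ℝ) ^ 2) := by rw [mul_pow]; gcongr
    have h3 : 68 * B ^ 4 * (n : ℝ) ^ 2 < n * (n : ℝ) ^ 2 := by gcongr
    have h4 : (n : ℝ) * (n : ℝ) ^ 2 ≤ n ^ 4 := by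
      rw [← pow_succ']
      exact pow_le_pow_right₀ (by linarith) (by norm_num)
    linarith
  · exact hf.comp (lat_injective.injOn.bijOn_image)
  · intro x hx z hz hxb hzb
    have := (h R (by linarith) (lat x) ⟨⟨x, hx, rfl⟩, by
      rw [mem_ball_zero_iff]; linarith [hball x hxb]⟩ (lat z) ⟨⟨z, hz, rfl⟩, by
      rw [mem_ball_zero_iff]; linarith [hball z hzb]⟩).1
    exact this.trans (mul_le_mul_of_nonneg_right hML dist_nonneg)
  · intro x hx z hz hxb hdist
    push_cast at hdist
    by_cases hzR : ‖lat z‖ < R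
    · have := (h R (by linarith) (lat x) ⟨⟨x, hx, rfl⟩, by
        rw [mem_ball_zero_iff]; linarith [hball x hxb]⟩ (lat z) ⟨⟨z, hz, rfl⟩, by
        rw [mem_ball_zero_iff]; exact hzR⟩).2
      exact this.trans (mul_le_mul_of_nonneg_right hML dist_nonneg)
    · exfalso
      push Not at hzR
      set S : ℝ := ‖lat z‖ + 1 with hS
      have h1 := (h S (by linarith) (lat x) ⟨⟨x, hx, rfl⟩, by
        rw [mem_ball_zero_iff]; linarith [hball x hxb]⟩ (lat z) ⟨⟨z, hz, rfl⟩, by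
        rw [mem_ball_zero_iff]; linarith⟩).2
      have hS1 : 1 ≤ S := by linarith
      have hsqrt : Real.log S ^ (1 / 24 : ℝ) ≤ √S := by
        rw [Real.sqrt_eq_rpow]
        refine (Real.rpow_le_rpow (Real.log_nonneg hS1)
          (Real.log_le_self (by linarith)) (by norm_num)).trans ?_
        exact Real.rpow_le_rpow_of_exponent_le hS1 (by norm_num)
      have h2 : dist (lat x) (lat z) ≤ M' * √S * ρ := by
        refine h1.trans ?_
        have h3 : M * Real.log S ^ (1 / 24 : ℝ) ≤ M' * √S := by
          have := hpow1 S (by linarith)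
          exact mul_le_mul hMM hsqrt (by linarith) (by linarith)
        exact mul_le_mul h3 hdist dist_nonneg (by positivity)
      have h3 : ‖lat z‖ ≤ dist (lat x) (lat z) + ‖lat x‖ := by
        rw [dist_comm, dist_eq_norm]
        simpa using norm_add_le (lat z - lat x) (lat x)
      have h4 := hball x hxb
      set s := √S with hs
      have hss : s ^ 2 = S := Real.sq_sqrt (by linarith)
      have hs1 : 1 ≤ s := Real.one_le_sqrt.2 hS1
      have hρ1 : 1 ≤ ρ := by linarith
      have h5 : s * s ≤ (1 + d + M') * ρ * s := by
        have e1 : d * ρ ≤ d * ρ * s := le_mul_of_one_le_right (by positivity) hs1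
        have e2 : 1 ≤ ρ * s := one_le_mul_of_one_le_of_one_le hρ1 hs1
        nlinarith
      have h6 := le_of_mul_le_mul_right h5 (by linarith)
      have h7 : s < ρ ^ 2 := by
        refine h6.trans_lt ?_
        rw [sq]
        gcongr
        linarith
      have h8 : s ^ 2 < (ρ ^ 2) ^ 2 := by gcongr
      have h9 : (ρ ^ 2) ^ 2 = R := by rw [hR]; ring
      linarith

end Net

/-- For `d ≥ 2` there are `α₀ > 0` and a separated net `X ⊆ ℝ^d` such that for
every bijection `f : X → ℤ^d` we have
`limsup_{R → ∞} biLip(f|_{X ∩ B(0,R)}) / (log R)^{α₀} = ∞`; the limsup being infinite is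
expressed as: for every `M` and every `R₀` there is `R ≥ R₀` such that `M * (log R)^{α₀}` fails
to be a bi-Lipschitz constant for the restriction of `f` to `X ∩ B(0,R)`. -/
theorem statement_1 (d : ℕ) (hd : 2 ≤ d) :
    ∃ α₀ : ℝ, 0 < α₀ ∧ ∃ X : Set (Euc d), IsSeparatedNet X ∧
      ∀ f : Euc d → Euc d, Set.BijOn f X (intLattice d) →
        ∀ M : ℝ, ∀ R₀ : ℝ, ∃ R : ℝ, R₀ ≤ R ∧
          ¬ (∀ x ∈ X ∩ ball 0 R, ∀ y ∈ X ∩ ball 0 R,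
              dist (f x) (f y) ≤ (M * (Real.log R) ^ α₀) * dist x y ∧
              dist x y ≤ (M * (Real.log R) ^ α₀) * dist (f x) (f y)) := by
  obtain ⟨i₀, i₁, h01⟩ : ∃ i₀ i₁ : Fin d, i₀ ≠ i₁ :=
    ⟨⟨0, by omega⟩, ⟨1, by omega⟩, by simp⟩
  refine ⟨1 / 24, by norm_num, lat '' net i₀ i₁, isSeparatedNet_net i₀ i₁, fun f hf M R₀ => ?_⟩
  by_contra! hcon
  obtain ⟨φ, L, n, hn, hφ⟩ := exists_controlled hf hcon
  exact not_controlled h01 hn hφ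
end
end
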